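/- For every positive integer n, the number of representations of n by x1^2 + x2^2 + 2x3^2 + 4(x4^2+x5^2+x6^2+x7^2+x8^2) equals (4/11)σ_{3;χ8,1}(n) + (2/11)σ_{3;1,χ8}(n/2) + (12/11)a1(n) + (28/11)a2(n) + (92/11)a1(n/2) − (28/11)a2(n/2), with terms of non-integer argument interpreted as 0. -/

import Mathlib

open Complex Real Finset

/-- The Dedekind eta function `η(z) = q^{1/24} ∏ (1 - q^m)`, `q = e^{2πiz}`. -/
noncomputable def dedekindEta (z : ℂ) : ℂ :=
  Complex.exp (Real.pi * Complex.I * z / 12) *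
    ∏' m : ℕ, (1 - Complex.exp (2 * Real.pi * Complex.I * (m + 1) * z))

/-- `repCount a n` is the number of `(x₁,…,x₈) ∈ ℤ⁸` with `∑ aᵢ xᵢ² = n`. -/
noncomputable def repCount (a : Fin 8 → ℕ) (n : ℕ) : ℕ :=
  Nat.card {x : Fin 8 → ℤ // ∑ i, (a i : ℤ) * x i ^ 2 = (n : ℤ)}

/-- `σ_{3;1,χ₈}(n) = ∑_{d ∣ n} χ₈(d) d³`. -/
def sigmaOneChi8 (n : ℕ) : ℤ := ∑ d ∈ n.divisors, ZMod.χ₈ (d : ZMod 8) * (d : ℤ) ^ 3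

/-- `σ_{3;χ₈,1}(n) = ∑_{d ∣ n} χ₈(n/d) d³`. -/
def sigmaChi8One (n : ℕ) : ℤ := ∑ d ∈ n.divisors, ZMod.χ₈ ((n / d : ℕ) : ZMod 8) * (d : ℤ) ^ 3

/-- `f(n/2)` when `2 ∣ n`, and `0` otherwise. -/
def half (f : ℕ → ℤ) (n : ℕ) : ℚ := if 2 ∣ n then (f (n / 2) : ℚ) else 0


/-! ### q-Pochhammer symbols -/

/-- infinite q-Pochhammer symbol -/
noncomputable def qP (a q : ℂ) : ℂ := ∏' i : ℕ, (1 - a * q ^ i)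

/-- finite q-Pochhammer symbol -/
noncomputable def qPn (a q : ℂ) (n : ℕ) : ℂ := ∏ i ∈ range n, (1 - a * q ^ i)

lemma summable_norm_geo (a : ℂ) {q : ℂ} (hq : ‖q‖ < 1) : Summable fun i : ℕ => ‖-(a * q ^ i)‖ := by
  simp only [norm_neg, norm_mul, norm_pow]
  exact (summable_geometric_of_lt_one (norm_nonneg _) hq).mul_left _

lemma qP_multipliable (a : ℂ) {q : ℂ} (hq : ‖q‖ < 1) : Multipliable fun i : ℕ => 1 - a * q ^ i := by
  have := multipliable_one_add_of_summable (summable_norm_geo a hq)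
  simpa [sub_eq_add_neg] using this

lemma qPn_tendsto (a : ℂ) {q : ℂ} (hq : ‖q‖ < 1) :
    Filter.Tendsto (qPn a q) Filter.atTop (nhds (qP a q)) :=
  (qP_multipliable a hq).hasProd.tendsto_prod_nat

lemma qP_ne_zero {a q : ℂ} (hq : ‖q‖ < 1) (h : ∀ i : ℕ, a * q ^ i ≠ 1) : qP a q ≠ 0 := by
  have := tprod_one_add_ne_zero_of_summable (f := fun i : ℕ => -(a * q ^ i))
    (fun i => by
      have := h i
      rw [← sub_eq_add_neg]; exact sub_ne_zero.mpr this.symm) (summable_norm_geo a hq)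
  simpa [qP, sub_eq_add_neg] using this

lemma qPn_ne_zero {a q : ℂ} (h : ∀ i : ℕ, a * q ^ i ≠ 1) (n : ℕ) : qPn a q n ≠ 0 :=
  Finset.prod_ne_zero_iff.mpr fun i _ => sub_ne_zero.mpr (h i).symm

lemma qP_ne_zero_of_norm {a q : ℂ} (hq : ‖q‖ < 1) (ha : ‖a‖ < 1) : qP a q ≠ 0 := by
  refine qP_ne_zero hq fun i h => ?_
  have h1 : ‖a * q ^ i‖ < 1 := by
    rw [norm_mul, norm_pow]
    calc ‖a‖ * ‖q‖ ^ i ≤ ‖a‖ * 1 := by gcongr; exact pow_le_one₀ (norm_nonneg _) hq.le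
      _ < 1 := by simpa
  rw [h] at h1; simp at h1

lemma qP_shift (a : ℂ) {q : ℂ} (hq : ‖q‖ < 1) : qP a q = (1 - a) * qP (a * q) q := by
  unfold qP
  rw [tprod_eq_zero_mul']
  · simp [pow_succ', mul_assoc]
  · have := qP_multipliable (a * q) hq
    simpa [pow_succ', mul_assoc] using this

lemma norm_sq_lt {q : ℂ} (hq : ‖q‖ < 1) : ‖q ^ 2‖ < 1 := by
  rw [norm_pow]; exact pow_lt_one₀ (norm_nonneg _) hq two_ne_zero

lemma norm_pow_lt {q : ℂ} (hq : ‖q‖ < 1) {k : ℕ} (hk : k ≠ 0) : ‖q ^ k‖ < 1 := by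
  rw [norm_pow]; exact pow_lt_one₀ (norm_nonneg _) hq hk

lemma qP_split (a : ℂ) {q : ℂ} (hq : ‖q‖ < 1) : qP a q = qP a (q ^ 2) * qP (a * q) (q ^ 2) := by
  unfold qP
  rw [← tprod_even_mul_odd (f := fun i : ℕ => 1 - a * q ^ i)]
  · simp only [pow_mul, pow_succ, mul_assoc]
    congr 1
    refine tprod_congr fun i => ?_
    ring
  · simpa only [pow_mul] using qP_multipliable a (norm_sq_lt hq)
  · have := qP_multipliable (a * q) (norm_sq_lt hq)
    refine this.congr fun i => ?_
    ring

lemma qP_neg_mul (a : ℂ) {q : ℂ} (hq : ‖q‖ < 1) : qP a q * qP (-a) q = qP (a ^ 2) (q ^ 2) := by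
  unfold qP
  rw [← (qP_multipliable a hq).tprod_mul (qP_multipliable (-a) hq)]
  refine tprod_congr fun i => ?_
  ring

/-- Euler product -/
noncomputable def ee (q : ℂ) : ℂ := qP q q

lemma ee_ne_zero {q : ℂ} (hq : ‖q‖ < 1) : ee q ≠ 0 := qP_ne_zero_of_norm hq hq

lemma qP_odd {q : ℂ} (hq : ‖q‖ < 1) : qP q (q ^ 2) = ee q / ee (q ^ 2) := by
  rw [eq_div_iff (ee_ne_zero (norm_sq_lt hq)), ee, ee, qP_split q hq, ← sq]

lemma qP_neg_self {q : ℂ} (hq : ‖q‖ < 1) : qP (-q) q = ee (q ^ 2) / ee q := by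
  rw [eq_div_iff (ee_ne_zero hq), ee, ee, mul_comm, qP_neg_mul q hq]

lemma qP_neg_odd {q : ℂ} (hq : ‖q‖ < 1) :
    qP (-q) (q ^ 2) = ee (q ^ 2) ^ 2 / (ee q * ee (q ^ 4)) := by
  have h := qP_neg_mul q (norm_sq_lt hq)
  rw [qP_odd hq, qP_odd (norm_sq_lt hq), ← pow_mul] at h
  have h1 := ee_ne_zero hq
  have h2 := ee_ne_zero (norm_sq_lt hq)
  have h4 := ee_ne_zero (norm_pow_lt hq (k := 4) (by norm_num))
  norm_num at h
  field_simp at h ⊢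
  linear_combination h

lemma exists_bound_of_tendsto {u : ℕ → ℂ} {l : ℂ} (h : Filter.Tendsto u Filter.atTop (nhds l)) :
    ∃ C : ℝ, 0 < C ∧ ∀ n, ‖u n‖ ≤ C := by
  obtain ⟨C, hC⟩ := (Metric.isBounded_range_of_tendsto u h).exists_norm_le
  refine ⟨max C 1, by positivity, fun n => le_max_of_le_left (hC _ ⟨n, rfl⟩)⟩

lemma qPn_bound (a : ℂ) {q : ℂ} (hq : ‖q‖ < 1) : ∃ C : ℝ, 0 < C ∧ ∀ n, ‖qPn a q n‖ ≤ C :=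
  exists_bound_of_tendsto (qPn_tendsto a hq)

lemma qPn_inv_bound {a q : ℂ} (hq : ‖q‖ < 1) (h : ∀ i : ℕ, a * q ^ i ≠ 1) :
    ∃ C : ℝ, 0 < C ∧ ∀ n, ‖(qPn a q n)⁻¹‖ ≤ C :=
  exists_bound_of_tendsto ((qPn_tendsto a hq).inv₀ (qP_ne_zero hq h))

lemma qPn_succ (a q : ℂ) (n : ℕ) : qPn a q (n + 1) = qPn a q n * (1 - a * q ^ n) := by
  simp [qPn, prod_range_succ]


/-! ### Jacobi triple product -/

/-- Gaussian binomial coefficients -/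
noncomputable def qbin (q : ℂ) : ℕ → ℕ → ℂ
  | _, 0 => 1
  | 0, _ + 1 => 0
  | M + 1, j + 1 => q ^ (j + 1) * qbin q M (j + 1) + qbin q M j

lemma qbin_eq_zero (q : ℂ) : ∀ M j : ℕ, M < j → qbin q M j = 0
  | _, 0, h => by omega
  | 0, _ + 1, _ => by simp [qbin]
  | M + 1, j + 1, h => by
    rw [qbin, qbin_eq_zero q M (j + 1) (by omega), qbin_eq_zero q M j (by omega)]; simp

lemma qbin_theorem (q : ℂ) (M : ℕ) : ∀ y : ℂ,
    ∏ k ∈ range M, (1 + y * q ^ k) = ∑ j ∈ range (M + 1), q ^ (j.choose 2) * qbin q M j * y ^ j := by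
  induction M with
  | zero => intro y; simp [qbin]
  | succ M ih =>
    intro y
    rw [prod_range_succ']
    have h1 : ∀ k, 1 + y * q ^ (k + 1) = 1 + (y * q) * q ^ k := fun k => by ring
    simp only [h1]
    rw [ih (y * q), Finset.sum_range_succ' _ (M + 1)]
    have h2 : ∀ j, q ^ ((j + 1).choose 2) * qbin q (M + 1) (j + 1) * y ^ (j + 1)
        = q ^ ((j + 1).choose 2) * qbin q M (j + 1) * (y * q) ^ (j + 1)
          + y * (q ^ (j.choose 2) * qbin q M j * (y * q) ^ j) := by
      intro j
      have : (j + 1).choose 2 = j + j.choose 2 := by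
        rw [Nat.choose_succ_succ' j 1]; simp
      rw [this, qbin]; ring
    simp only [h2]
    rw [Finset.sum_add_distrib, ← Finset.mul_sum]
    have h3 : ∑ j ∈ range (M + 1), q ^ ((j + 1).choose 2) * qbin q M (j + 1) * (y * q) ^ (j + 1)
        = ∑ j ∈ range (M + 1), q ^ (j.choose 2) * qbin q M j * (y * q) ^ j - 1 := by
      rw [Finset.sum_range_succ _ M, Finset.sum_range_succ' _ M, qbin_eq_zero q M (M + 1) (by omega)]
      simp [qbin]
    rw [h3]
    simp [qbin]; ring

lemma qbin_mul (q : ℂ) : ∀ M i j : ℕ, M = j + i →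
    qbin q M j * (qPn q q j * qPn q q i) = qPn q q M
  | 0, i, j, h => by
    obtain rfl : j = 0 := by omega
    obtain rfl : i = 0 := by omega
    simp [qbin, qPn]
  | M + 1, i, 0, h => by
    obtain rfl : i = M + 1 := by omega
    simp [qbin, qPn]
  | M + 1, 0, j + 1, h => by
    obtain rfl : j = M := by omega
    have h1 := qbin_mul q j 0 j rfl
    rw [qbin, qbin_eq_zero q j (j + 1) (by omega), qPn_succ]
    linear_combination (1 - q * q ^ j) * h1
  | M + 1, i + 1, j + 1, h => by
    have h1 := qbin_mul q M i (j + 1) (by omega)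
    have h2 := qbin_mul q M (i + 1) j (by omega)
    rw [qbin, qPn_succ q q M, qPn_succ q q i, qPn_succ q q j]
    rw [qPn_succ q q j] at h1
    rw [qPn_succ q q i] at h2
    obtain rfl : M = j + 1 + i := by omega
    linear_combination q ^ (j + 1) * (1 - q * q ^ i) * h1 + (1 - q * q ^ j) * h2

lemma pow_ne_one_of_norm {q : ℂ} (hq : ‖q‖ < 1) (i : ℕ) : q * q ^ i ≠ 1 := by
  intro h
  have h1 : ‖q ^ (i + 1)‖ < 1 := norm_pow_lt hq (by omega)
  rw [pow_succ', h] at h1; simp at h1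

/-- finite triple product -/
lemma triple_finite {q x : ℂ} (hq0 : q ≠ 0) (hx : x ≠ 0) (N : ℕ) :
    qPn (-x * q) (q ^ 2) N * qPn (-q / x) (q ^ 2) N =
      ∑ j ∈ range (2 * N + 1), q ^ (((j : ℤ) - N) ^ 2) * x ^ ((j : ℤ) - N) * qbin (q ^ 2) (2 * N) j := by
  have h := qbin_theorem (q ^ 2) (2 * N) (x * q ^ (1 - 2 * (N : ℤ)))
  have hL : ∏ k ∈ range (2 * N), (1 + x * q ^ (1 - 2 * (N : ℤ)) * (q ^ 2) ^ k)
      = qPn (-x * q) (q ^ 2) N * qPn (-q / x) (q ^ 2) N * (x ^ (N : ℤ) * q ^ (-(N : ℤ) ^ 2)) := by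
    rw [two_mul, prod_range_add, ← Finset.prod_range_reflect]
    have e1 : ∀ k ∈ range N, (1 + x * q ^ (1 - 2 * (N : ℤ)) * (q ^ 2) ^ (N - 1 - k))
        = (1 - -q / x * (q ^ 2) ^ k) * (x * q ^ (-(2 * (k : ℤ) + 1))) := by
      intro k hk
      rw [mem_range] at hk
      have : (q ^ 2) ^ (N - 1 - k) = q ^ (2 * ((N : ℤ) - 1 - k)) := by
        rw [← pow_mul, ← zpow_natCast]; congr 1; push_cast
        rw [Nat.cast_sub (by omega), Nat.cast_sub (by omega)]; push_cast; ring
      rw [this, mul_assoc, ← zpow_add₀ hq0]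
      have e2 : (1 - 2 * (N : ℤ) + 2 * ((N : ℤ) - 1 - k)) = -(2 * (k : ℤ) + 1) := by ring
      rw [e2]
      have : q ^ (-(2 * (k : ℤ) + 1)) * (q * (q ^ 2) ^ k) = 1 := by
        rw [← pow_mul, ← pow_succ', zpow_neg]
        have : q ^ (2 * (k : ℤ) + 1) = q ^ (2 * k + 1) := by
          rw [← zpow_natCast]; push_cast; rfl
        rw [this]
        exact inv_mul_cancel₀ (pow_ne_zero _ hq0)
      field_simp
      linear_combination -this
    have e3 : ∀ k ∈ range N, (1 + x * q ^ (1 - 2 * (N : ℤ)) * (q ^ 2) ^ (N + k))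
        = (1 - -x * q * (q ^ 2) ^ k) := by
      intro k hk
      have : q ^ (1 - 2 * (N : ℤ)) * (q ^ 2) ^ (N + k) = q * (q ^ 2) ^ k := by
        rw [← pow_mul, ← pow_mul, ← pow_succ', ← zpow_natCast, ← zpow_natCast, ← zpow_add₀ hq0]
        congr 1; push_cast; ring
      rw [mul_assoc, this]; ring
    rw [prod_congr rfl e1, prod_congr rfl e3, prod_mul_distrib]
    have e4 : ∏ k ∈ range N, (x * q ^ (-(2 * (k : ℤ) + 1))) = x ^ (N : ℤ) * q ^ (-(N : ℤ) ^ 2) := by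
      clear e1 e3 h
      induction N with
      | zero => simp
      | succ N ih =>
        rw [prod_range_succ, ih]
        have : (-((N + 1 : ℕ) : ℤ) ^ 2) = -(N : ℤ) ^ 2 + -(2 * (N : ℤ) + 1) := by push_cast; ring
        rw [this, zpow_add₀ hq0]; push_cast; rw [zpow_add₀ hx]; simp; ring
    rw [e4, qPn, qPn]; ring
  rw [hL] at h
  have hne : x ^ (N : ℤ) * q ^ (-(N : ℤ) ^ 2) ≠ 0 :=
    mul_ne_zero (zpow_ne_zero _ hx) (zpow_ne_zero _ hq0)
  apply mul_right_cancel₀ hne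
  rw [h, Finset.sum_mul]
  refine Finset.sum_congr rfl fun j hj => ?_
  have e5 : (q ^ 2) ^ (j.choose 2) * (q ^ (1 - 2 * (N : ℤ))) ^ j
      = q ^ (((j : ℤ) - N) ^ 2) * q ^ (-(N : ℤ) ^ 2) := by
    rw [← pow_mul, ← zpow_natCast, ← zpow_natCast, ← zpow_mul, ← zpow_add₀ hq0, ← zpow_add₀ hq0]
    congr 1
    have : (2 * j.choose 2 : ℕ) + j = j * j := by
      rw [Nat.choose_two_right, mul_comm 2, Nat.div_mul_cancel (Nat.even_mul_pred_self j).two_dvd]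
      cases j with
      | zero => rfl
      | succ n => simp; ring
    zify at this
    push_cast
    linear_combination this
  have e6 : x ^ j = x ^ ((j : ℤ) - N) * x ^ (N : ℤ) := by
    rw [← zpow_add₀ hx]; simp
  rw [mul_pow, e6]
  linear_combination (x ^ ((j : ℤ) - N) * x ^ (N : ℤ)) * qbin (q ^ 2) (2 * N) j * e5

open Filter in
theorem triple_product {q x : ℂ} (hq : ‖q‖ < 1) (hq0 : q ≠ 0) (hx : x ≠ 0)
    (hs : Summable fun n : ℤ => ‖q ^ (n ^ 2) * x ^ n‖) :
    ∑' n : ℤ, q ^ (n ^ 2) * x ^ n = ee (q ^ 2) * (qP (-x * q) (q ^ 2) * qP (-q / x) (q ^ 2)) := by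
  have hQ := norm_sq_lt hq
  set Q := q ^ 2 with hQd
  have hne : ∀ i : ℕ, Q * Q ^ i ≠ 1 := pow_ne_one_of_norm hQ
  let G : ℕ → ℤ → ℂ := fun N n => if n.natAbs ≤ N then
      q ^ (n ^ 2) * x ^ n * qbin Q (2 * N) (n + N).toNat else 0
  have hG : ∀ N, ∑' n, G N n = qPn (-x * q) Q N * qPn (-q / x) Q N := by
    intro N
    rw [hQd, triple_finite hq0 hx]
    rw [tsum_eq_sum (s := Finset.Icc (-N : ℤ) N)]
    · symm
      refine Finset.sum_bij (fun j _ => (j : ℤ) - N) ?_ ?_ ?_ ?_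
      · intro j hj; simp at hj ⊢; omega
      · intro a _ b _ h; simpa using h
      · intro b hb; simp at hb
        refine ⟨(b + N).toNat, ?_, ?_⟩
        · simp; omega
        · omega
      · intro j hj
        simp at hj
        have : ((j : ℤ) - N).natAbs ≤ N := by omega
        simp only [G, this, if_true]
        congr 2; omega
    · intro n hn
      simp at hn
      have : ¬ n.natAbs ≤ N := by intro h; have := hn (by omega); omega
      simp [G, this]
  obtain ⟨C1, hC1, hb1⟩ := qPn_bound Q hQ
  obtain ⟨C2, hC2, hb2⟩ := qPn_inv_bound hQ hne
  have hqb : ∀ N : ℕ, ∀ n : ℤ, n.natAbs ≤ N → qbin Q (2 * N) (n + N).toNat =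
      qPn Q Q (2 * N) * ((qPn Q Q (n + N).toNat)⁻¹ * (qPn Q Q (N - n).toNat)⁻¹) := by
    intro N n h
    have := qbin_mul Q (2 * N) (N - n).toNat (n + N).toNat (by omega)
    have h1 := qPn_ne_zero hne (n + N).toNat
    have h2 := qPn_ne_zero hne (N - n).toNat
    field_simp
    linear_combination this
  have hlim : Tendsto (fun N => ∑' n, G N n) atTop
      (nhds (∑' n : ℤ, q ^ (n ^ 2) * x ^ n * (qP Q Q * ((qP Q Q)⁻¹ * (qP Q Q)⁻¹)))) := by
    refine tendsto_tsum_of_dominated_convergence (bound := fun n => ‖q ^ (n ^ 2) * x ^ n‖ * (C1 * (C2 * C2)))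
      (hs.mul_right _) ?_ ?_
    · intro n
      have ev : ∀ᶠ N in atTop, q ^ (n ^ 2) * x ^ n * (qPn Q Q (2 * N) *
          ((qPn Q Q (n + N).toNat)⁻¹ * (qPn Q Q (N - n).toNat)⁻¹)) = G N n := by
        filter_upwards [eventually_ge_atTop n.natAbs] with N hN
        simp only [G, hN, if_true, hqb N n hN]
      refine Tendsto.congr' ev ?_
      have t1 : Tendsto (fun N : ℕ => 2 * N) atTop atTop := tendsto_atTop_mono (f := fun N : ℕ => N) (fun N => by omega) tendsto_id
      have t2 : Tendsto (fun N : ℕ => (n + N).toNat) atTop atTop :=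
        tendsto_atTop_mono (f := fun N : ℕ => N - n.natAbs) (fun N => by omega) (tendsto_sub_atTop_nat _)
      have t3 : Tendsto (fun N : ℕ => ((N : ℤ) - n).toNat) atTop atTop :=
        tendsto_atTop_mono (f := fun N : ℕ => N - n.natAbs) (fun N => by omega) (tendsto_sub_atTop_nat _)
      have T := qPn_tendsto Q hQ
      have T' := T.inv₀ (qP_ne_zero hQ hne)
      exact ((T.comp t1).mul ((T'.comp t2).mul (T'.comp t3))).const_mul _
    · refine Eventually.of_forall fun N n => ?_
      by_cases h : n.natAbs ≤ N
      · simp only [G, h, if_true, hqb N n h]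
        rw [norm_mul]
        gcongr
        rw [norm_mul, norm_mul]
        gcongr <;> first | exact hb1 _ | exact hb2 _
      · simp only [G, h, if_false, norm_zero]; positivity
  have hlim2 : Tendsto (fun N => ∑' n, G N n) atTop
      (nhds (qP (-x * q) Q * qP (-q / x) Q)) := by
    simp only [hG]
    exact (qPn_tendsto _ hQ).mul (qPn_tendsto _ hQ)
  have := tendsto_nhds_unique hlim hlim2
  rw [tsum_mul_right] at this
  rw [← this, ee]
  have := qP_ne_zero hQ hne
  field_simp


/-! ### theta functions -/

lemma tsum_split_two {α β γ : Type*} {f : β → ℂ} (hf : Summable f) {i : α → β} {j : γ → β}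
    (hi : Function.Injective i) (hj : Function.Injective j)
    (hdis : ∀ a c, i a ≠ j c) (hcov : ∀ b, (∃ a, i a = b) ∨ ∃ c, j c = b) :
    ∑' b, f b = ∑' a, f (i a) + ∑' c, f (j c) := by
  have h1 : HasSum (f ∘ i) (∑' a, f (i a)) := (hf.comp_injective hi).hasSum
  have h2 : HasSum (f ∘ j) (∑' a, f (j a)) := (hf.comp_injective hj).hasSum
  have h3 := (hi.hasSum_range_iff (f := f)).2 h1
  have h4 := (hj.hasSum_range_iff (f := f)).2 h2
  refine (h3.add_isCompl ?_ h4).tsum_eq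
  rw [isCompl_iff]
  constructor
  · rw [Set.disjoint_left]
    rintro _ ⟨a, rfl⟩ ⟨c, hc⟩
    exact hdis a c hc.symm
  · rw [codisjoint_iff]
    ext b
    simp only [Set.sup_eq_union, Set.mem_union, Set.mem_range, Set.top_eq_univ, Set.mem_univ, iff_true]
    exact hcov b

lemma summable_natAbs {r : ℝ} (h0 : 0 ≤ r) (h1 : r < 1) : Summable fun n : ℤ => r ^ n.natAbs := by
  refine Summable.of_nat_of_neg ?_ ?_ <;>
  simpa using summable_geometric_of_lt_one h0 h1

/-- theta function -/
noncomputable def phi (q : ℂ) : ℂ := ∑' n : ℤ, q ^ (n ^ 2)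

/-- second theta function -/
noncomputable def psi (q : ℂ) : ℂ := ∑' n : ℤ, q ^ (n ^ 2 + n)

lemma zpow_le_natAbs {r : ℝ} (h0 : 0 < r) (h1 : r < 1) {m : ℤ} {n : ℕ} (h : (n : ℤ) ≤ m) :
    r ^ m ≤ r ^ n := by
  rw [← zpow_natCast]
  exact (zpow_le_zpow_iff_right_of_lt_one₀ h0 h1).2 h

lemma natAbs_le_sq (n : ℤ) : (n.natAbs : ℤ) ≤ n ^ 2 := by
  have := Int.natAbs_le_self_sq n
  exact_mod_cast this

lemma phi_summable {q : ℂ} (hq0 : q ≠ 0) (hq : ‖q‖ < 1) : Summable fun n : ℤ => ‖q ^ (n ^ 2)‖ := by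
  refine (summable_natAbs (norm_nonneg q) hq).of_nonneg_of_le (fun _ => norm_nonneg _) fun n => ?_
  rw [norm_zpow]
  exact zpow_le_natAbs (norm_pos_iff.2 hq0) hq (natAbs_le_sq n)

lemma psi_summable {q : ℂ} (hq0 : q ≠ 0) (hq : ‖q‖ < 1) :
    Summable fun n : ℤ => ‖q ^ (n ^ 2 + n)‖ := by
  refine ((summable_natAbs (norm_nonneg q) hq).mul_left ‖q‖⁻¹).of_nonneg_of_le (fun _ => norm_nonneg _) fun n => ?_
  have hp := norm_pos_iff.2 hq0
  rw [norm_zpow, ← zpow_natCast, ← zpow_neg_one, ← zpow_add₀ hp.ne']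
  refine (zpow_le_zpow_iff_right_of_lt_one₀ hp hq).2 ?_
  rcases le_or_gt 0 n with h | h
  · have := sq_nonneg n; omega
  · have : n ^ 2 ≥ -2 * n - 1 := by nlinarith [sq_nonneg (n + 1)]
    omega

lemma phi_prod {q : ℂ} (hq0 : q ≠ 0) (hq : ‖q‖ < 1) :
    phi q = ee (q ^ 2) ^ 5 / (ee q ^ 2 * ee (q ^ 4) ^ 2) := by
  have := triple_product hq hq0 one_ne_zero (by simpa using phi_summable hq0 hq)
  have e : -q / 1 = -q := by simp
  simp only [one_zpow, mul_one] at this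
  rw [phi, this, e]
  rw [show -1 * q = -q by ring, qP_neg_odd hq]
  have h1 := ee_ne_zero hq
  have h4 := ee_ne_zero (norm_pow_lt hq (k := 4) (by norm_num))
  field_simp

lemma phi_neg_prod {q : ℂ} (hq0 : q ≠ 0) (hq : ‖q‖ < 1) :
    phi (-q) = ee q ^ 2 / ee (q ^ 2) := by
  have := triple_product (q := -q) (x := 1) (by simpa using hq) (by simpa using hq0) one_ne_zero
    (by simpa using phi_summable (q := -q) (by simpa using hq0) (by simpa using hq))
  simp only [one_zpow, mul_one] at this
  rw [phi, this]
  rw [show -1 * -q = q by ring, show - -q / 1 = q by ring, show (-q) ^ 2 = q ^ 2 by ring, qP_odd hq]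
  have h2 := ee_ne_zero (norm_pow_lt hq (k := 2) (by norm_num))
  field_simp

lemma psi_prod {q : ℂ} (hq0 : q ≠ 0) (hq : ‖q‖ < 1) :
    psi q = 2 * ee (q ^ 4) ^ 2 / ee (q ^ 2) := by
  have e : ∀ n : ℤ, q ^ (n ^ 2 + n) = q ^ (n ^ 2) * q ^ n := fun n => zpow_add₀ hq0 _ _
  have := triple_product (q := q) (x := q) hq hq0 hq0
    (by simpa only [e] using psi_summable (q := q) hq0 hq)
  have hs := norm_sq_lt hq
  rw [psi]
  simp only [e]
  rw [this, show -q / q = -1 by field_simp, qP_shift (-1) hs, show -q * q = - q ^ 2 by ring,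
    show -1 * q ^ 2 = - q ^ 2 by ring, qP_neg_self hs]
  have h2 := ee_ne_zero hs
  rw [← pow_mul]
  norm_num
  field_simp

lemma phi_split {q : ℂ} (hq0 : q ≠ 0) (hq : ‖q‖ < 1) : phi q = phi (q ^ 4) + q * psi (q ^ 4) := by
  rw [phi, tsum_split_two (i := fun n : ℤ => 2 * n) (j := fun n : ℤ => 2 * n + 1)
    (phi_summable hq0 hq).of_norm]
  · rw [phi, psi, ← tsum_mul_left]
    congr 1
    · refine tsum_congr fun n => ?_
      rw [← zpow_natCast, ← zpow_mul]; congr 1; push_cast; ring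
    · refine tsum_congr fun n => ?_
      rw [← zpow_natCast, ← zpow_mul, ← zpow_one_add₀ hq0]; congr 1; push_cast; ring
  · intro a b h; simpa using h
  · intro a b h; simpa using h
  · intro a b; omega
  · intro b
    rcases Int.even_or_odd' b with ⟨k, h | h⟩
    · exact Or.inl ⟨k, h.symm⟩
    · exact Or.inr ⟨k, h.symm⟩

lemma phi_sq {q : ℂ} (hq0 : q ≠ 0) (hq : ‖q‖ < 1) :
    phi q ^ 2 = phi (q ^ 2) ^ 2 + q * psi (q ^ 2) ^ 2 := by
  have hs := norm_sq_lt hq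
  have hs0 : q ^ 2 ≠ 0 := pow_ne_zero _ hq0
  have s1 := phi_summable hq0 hq
  have s2 := phi_summable hs0 hs
  have s3 := psi_summable hs0 hs
  rw [sq (phi q), sq (phi (q ^ 2)), sq (psi (q ^ 2)), phi, phi, psi, tsum_mul_tsum_of_summable_norm s1 s1, tsum_mul_tsum_of_summable_norm s2 s2,
    tsum_mul_tsum_of_summable_norm s3 s3]
  rw [tsum_split_two (i := fun p : ℤ × ℤ => (p.1 + p.2, p.1 - p.2))
    (j := fun p : ℤ × ℤ => (p.1 + p.2 + 1, p.1 - p.2))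
    (summable_mul_of_summable_norm s1 s1)]
  · rw [← tsum_mul_left]
    congr 1
    · refine tsum_congr fun n => ?_
      rw [← zpow_natCast, ← zpow_mul, ← zpow_mul, ← zpow_add₀ hq0, ← zpow_add₀ hq0]
      congr 1; push_cast; ring
    · refine tsum_congr fun n => ?_
      rw [← zpow_natCast, ← zpow_mul, ← zpow_mul, ← zpow_add₀ hq0, ← zpow_add₀ hq0, ← zpow_one_add₀ hq0]
      congr 1; push_cast; ring
  · rintro ⟨a, b⟩ ⟨c, d⟩ h; simp only [Prod.mk.injEq] at h ⊢; omega
  · rintro ⟨a, b⟩ ⟨c, d⟩ h; simp only [Prod.mk.injEq] at h ⊢; omega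
  · rintro ⟨a, b⟩ ⟨c, d⟩ h; simp only [Prod.mk.injEq] at h; omega
  · rintro ⟨a, b⟩
    rcases Int.even_or_odd' (a + b) with ⟨k, h | h⟩
    · exact Or.inl ⟨(k, k - b), by simp only [Prod.mk.injEq]; omega⟩
    · exact Or.inr ⟨(k, k - b), by simp only [Prod.mk.injEq]; omega⟩

lemma phi_neg_split {q : ℂ} (hq0 : q ≠ 0) (hq : ‖q‖ < 1) : phi (-q) = 2 * phi (q ^ 4) - phi q := by
  have h := phi_split (q := -q) (by simpa using hq0) (by simpa using hq)
  rw [show (-q) ^ 4 = q ^ 4 by ring] at h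
  rw [h, phi_split hq0 hq]; ring

lemma phi_neg_sq {q : ℂ} (hq0 : q ≠ 0) (hq : ‖q‖ < 1) :
    phi (-q) ^ 2 = 2 * phi (q ^ 2) ^ 2 - phi q ^ 2 := by
  have h := phi_sq (q := -q) (by simpa using hq0) (by simpa using hq)
  rw [show (-q) ^ 2 = q ^ 2 by ring] at h
  rw [h, phi_sq hq0 hq]; ring

/-- the relation between X, Y, Z -/
lemma phi_rel {q : ℂ} (hq0 : q ≠ 0) (hq : ‖q‖ < 1) :
    phi (q ^ 2) ^ 2 = phi q ^ 2 - 2 * phi q * phi (q ^ 4) + 2 * phi (q ^ 4) ^ 2 := by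
  have h1 := phi_neg_sq hq0 hq
  rw [phi_neg_split hq0 hq] at h1
  linear_combination -h1 / 2

lemma phi_sq_sub {q : ℂ} (hq0 : q ≠ 0) (hq : ‖q‖ < 1) :
    phi q ^ 2 - phi (q ^ 2) ^ 2 = 4 * q * ee (q ^ 8) ^ 4 / ee (q ^ 4) ^ 2 := by
  rw [phi_sq hq0 hq, psi_prod (pow_ne_zero _ hq0) (norm_sq_lt hq), ← pow_mul, ← pow_mul]
  ring


/-! ### Kronecker type sum -/

/-- theta product -/
noncomputable def th (a q : ℂ) : ℂ := qP a q * qP (q / a) q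

/-- bilateral sum -/
noncomputable def KK (a x q : ℂ) : ℂ := ∑' n : ℤ, x ^ n / (1 - a * q ^ n)

lemma pow_inj_of_norm {q : ℂ} (hq0 : q ≠ 0) (hq : ‖q‖ < 1) {i j : ℕ} (h : q ^ i = q ^ j) : i = j := by
  have h1 : ‖q‖ ^ i = ‖q‖ ^ j := by rw [← norm_pow, ← norm_pow, h]
  exact (pow_right_injective₀ (norm_pos_iff.2 hq0) hq.ne) h1

lemma lagrange_id {q : ℂ} (hq0 : q ≠ 0) (hq : ‖q‖ < 1) (x t : ℂ) (M : ℕ)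
    (ht : ∀ j ∈ range M, t ≠ q ^ j) :
    ∏ j ∈ range M, (t - x * q ^ j) = (∏ j ∈ range M, (t - q ^ j)) *
      (1 + ∑ i ∈ range M, (∏ j ∈ (range M).erase i, (q ^ i - q ^ j)⁻¹) *
        (t - q ^ i)⁻¹ * ∏ j ∈ range M, (q ^ i - x * q ^ j)) := by
  classical
  let s := range M
  let v : ℕ → ℂ := fun j => q ^ j
  let P := Lagrange.nodal s (fun j => x * q ^ j)
  have hinj : Set.InjOn v s := fun i _ j _ h => pow_inj_of_norm hq0 hq h
  have hdeg : (P - Lagrange.nodal s v).degree < (#s : ℕ) := by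
    have : (P - Lagrange.nodal s v).degree < P.degree := by
      apply Polynomial.degree_sub_lt
      · simp [P]
      · exact (Lagrange.nodal_monic).ne_zero
      · rw [Lagrange.nodal_monic, Lagrange.nodal_monic]
    simpa [P] using this
  have h := Lagrange.eq_interpolate_of_eval_eq (f := P - Lagrange.nodal s v)
    (fun i => Polynomial.eval (v i) P) hinj hdeg (by
      intro i hi
      rw [Polynomial.eval_sub, Lagrange.eval_nodal_at_node hi, sub_zero])
  have h2 := congrArg (Polynomial.eval t) h
  rw [Lagrange.eval_interpolate_not_at_node _ ht, Polynomial.eval_sub, Lagrange.eval_nodal,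
    Lagrange.eval_nodal] at h2
  simp only [P, Lagrange.eval_nodal, Lagrange.nodalWeight, v, s] at h2
  linear_combination h2

lemma zpow_split_prod (q : ℂ) (M j : ℕ) (hj : j < M) (g : ℕ → ℂ) :
    ∏ i ∈ range M, g i = (∏ i ∈ range j, g (j - 1 - i)) * ∏ i ∈ range (M - j), g (j + i) := by
  obtain ⟨k, rfl⟩ := Nat.exists_eq_add_of_lt hj
  rw [show j + k + 1 = j + (k + 1) by ring, prod_range_add, ← Finset.prod_range_reflect]
  simp

lemma lag_num {q x : ℂ} (hx : x ≠ 0) (M j : ℕ) (hj : j < M) :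
    ∏ i ∈ range M, (q ^ j - x * q ^ i) =
      (∏ i ∈ range j, (-q ^ i)) * x ^ j * qPn (q / x) q j * (q ^ j * (q ^ j) ^ (M - 1 - j) * qPn x q (M - j)) := by
  rw [zpow_split_prod q M j hj]
  congr 1
  · have e : ∀ i ∈ range j, q ^ j - x * q ^ (j - 1 - i) = (-q ^ (j - 1 - i)) * x * (1 - q / x * q ^ i) := by
      intro i hi
      rw [mem_range] at hi
      have : q ^ j = q ^ (j - 1 - i) * (q * q ^ i) := by
        rw [← pow_succ', ← pow_add]; congr 1; omega
      rw [this]; field_simp; ring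
    rw [prod_congr rfl e, prod_mul_distrib, prod_mul_distrib, prod_range_reflect (fun i => -q ^ i)]
    simp [qPn]
  · have e : ∀ i ∈ range (M - j), q ^ j - x * q ^ (j + i) = q ^ j * (1 - x * q ^ i) := by
      intro i hi; rw [pow_add]; ring
    rw [prod_congr rfl e, prod_mul_distrib]
    simp only [prod_const, card_range, qPn]
    rw [← pow_succ', show M - 1 - j + 1 = M - j by omega]

lemma lag_den {q : ℂ} (hq0 : q ≠ 0) (M j : ℕ) (hj : j < M) :
    ∏ i ∈ (range M).erase j, (q ^ j - q ^ i) =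
      (∏ i ∈ range j, (-q ^ i)) * qPn q q j * ((q ^ j) ^ (M - 1 - j) * qPn q q (M - 1 - j)) := by
  have hs : (range M).erase j = range j ∪ (range M \ range (j + 1)) := by
    ext i; simp; omega
  have hd : Disjoint (range j) (range M \ range (j + 1)) := by
    rw [Finset.disjoint_left]; intro i; simp; omega
  rw [hs, prod_union hd]
  congr 1
  · rw [← Finset.prod_range_reflect]
    have e : ∀ i ∈ range j, q ^ j - q ^ (j - 1 - i) = (-q ^ (j - 1 - i)) * (1 - q * q ^ i) := by
      intro i hi
      rw [mem_range] at hi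
      have : q ^ j = q ^ (j - 1 - i) * (q * q ^ i) := by
        rw [← pow_succ', ← pow_add]; congr 1; omega
      rw [this]; ring
    rw [prod_congr rfl e, prod_mul_distrib, prod_range_reflect (fun i => -q ^ i)]
    simp [qPn]
  · have : range M \ range (j + 1) = (range (M - 1 - j)).image (fun i => j + 1 + i) := by
      ext i; simp
      constructor
      · rintro ⟨h1, h2⟩; exact ⟨i - (j + 1), by omega, by omega⟩
      · rintro ⟨a, h1, h2⟩; omega
    rw [this, prod_image (by intro a _ b _ h; simpa using h)]
    have e : ∀ i ∈ range (M - 1 - j), q ^ j - q ^ (j + 1 + i) = q ^ j * (1 - q * q ^ i) := by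
      intro i hi; rw [pow_add, pow_add]; ring
    rw [prod_congr rfl e, prod_mul_distrib]
    simp [qPn]

/-- the coefficient in the partial fraction expansion -/
noncomputable def cc (x q : ℂ) (M j : ℕ) : ℂ :=
  qPn (q / x) q j * qPn x q (M - j) * ((qPn q q j)⁻¹ * (qPn q q (M - 1 - j))⁻¹)

lemma partial_fraction {q x t : ℂ} (hq0 : q ≠ 0) (hq : ‖q‖ < 1) (hx : x ≠ 0) (M : ℕ)
    (ht : ∀ j ∈ range M, t ≠ q ^ j) :
    ∏ j ∈ range M, (t - x * q ^ j) = (∏ j ∈ range M, (t - q ^ j)) *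
      (x ^ M + ∑ j ∈ range M, x ^ j * cc x q M j * (t / (t - q ^ j))) := by
  have hne := pow_ne_one_of_norm hq
  have key : ∀ i ∈ range M, (∏ j ∈ (range M).erase i, (q ^ i - q ^ j)⁻¹) *
        ∏ j ∈ range M, (q ^ i - x * q ^ j) = q ^ i * (x ^ i * cc x q M i) := by
    intro i hi
    rw [mem_range] at hi
    rw [prod_inv_distrib, lag_den hq0 M i hi, lag_num hx M i hi, cc]
    have h1 := qPn_ne_zero hne i
    have h2 := qPn_ne_zero hne (M - 1 - i)
    have h3 : (∏ i ∈ range i, (-q ^ i)) ≠ 0 :=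
      prod_ne_zero_iff.2 fun i _ => neg_ne_zero.2 (pow_ne_zero _ hq0)
    have h4 := pow_ne_zero i hq0
    field_simp
  have e : ∀ t, ∑ i ∈ range M, (∏ j ∈ (range M).erase i, (q ^ i - q ^ j)⁻¹) *
        (t - q ^ i)⁻¹ * ∏ j ∈ range M, (q ^ i - x * q ^ j)
      = ∑ i ∈ range M, q ^ i * (x ^ i * cc x q M i) * (t - q ^ i)⁻¹ := by
    intro t
    refine sum_congr rfl fun i hi => ?_
    rw [← key i hi]; ring
  have h0 := lagrange_id hq0 hq x 0 M (fun j _ => (pow_ne_zero _ hq0).symm)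
  have h1 := lagrange_id hq0 hq x t M ht
  rw [e] at h0 h1
  have h0' : ∏ j ∈ range M, (0 - x * q ^ j) = (∏ j ∈ range M, (0 - q ^ j)) * x ^ M := by
    have : ∀ j ∈ range M, (0 - x * q ^ j) = (0 - q ^ j) * x := fun j _ => by ring
    rw [prod_congr rfl this, prod_mul_distrib]; simp
  rw [h0'] at h0
  have hz : (∏ j ∈ range M, (0 - q ^ j)) ≠ 0 :=
    prod_ne_zero_iff.2 fun i _ => by simpa using pow_ne_zero i hq0
  have h0 := mul_left_cancel₀ hz h0
  rw [h1, h0, add_assoc, ← sum_add_distrib]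
  congr 2
  refine sum_congr rfl fun i hi => ?_
  have := sub_ne_zero.2 (ht i hi)
  have h4 := pow_ne_zero i hq0
  rw [zero_sub]
  field_simp
  ring


lemma zpow_ne_one_of_ne {a q : ℂ} (ha : ∀ n : ℤ, a * q ^ n ≠ 1) (n : ℤ) : 1 - a * q ^ n ≠ 0 :=
  sub_ne_zero.2 (ha n).symm

lemma inv_bound_pos {a q : ℂ} (hq : ‖q‖ < 1) :
    ∃ C : ℝ, 0 < C ∧ ∀ n : ℕ, ‖(1 - a * q ^ n)⁻¹‖ ≤ C := by
  apply exists_bound_of_tendsto (l := (1 - a * 0)⁻¹)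
  refine Filter.Tendsto.inv₀ ?_ (by simp)
  exact tendsto_const_nhds.sub ((tendsto_pow_atTop_nhds_zero_of_norm_lt_one hq).const_mul _)

lemma inv_bound_neg {a q : ℂ} (hq : ‖q‖ < 1) (ha : a ≠ 0) :
    ∃ C : ℝ, 0 < C ∧ ∀ n : ℕ, ‖(q ^ n - a)⁻¹‖ ≤ C := by
  apply exists_bound_of_tendsto (l := (0 - a)⁻¹)
  refine Filter.Tendsto.inv₀ ?_ (by simpa using ha)
  exact (tendsto_pow_atTop_nhds_zero_of_norm_lt_one hq).sub tendsto_const_nhds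

lemma KK_summable {a x q : ℂ} (hq0 : q ≠ 0) (hq : ‖q‖ < 1) (ha0 : a ≠ 0)
    (hqx : ‖q‖ < ‖x‖) (hx : ‖x‖ < 1) : Summable fun n : ℤ => ‖x ^ n / (1 - a * q ^ n)‖ := by
  have hx0 : x ≠ 0 := by
    rw [← norm_pos_iff]; exact (norm_nonneg q).trans_lt hqx
  obtain ⟨C, hC, hb⟩ := inv_bound_pos (a := a) hq
  obtain ⟨D, hD, hd⟩ := inv_bound_neg (a := a) hq ha0
  have hqx' : ‖q / x‖ < 1 := by
    rw [norm_div]; exact (div_lt_one (norm_pos_iff.2 hx0)).2 hqx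
  refine Summable.of_nat_of_neg ?_ ?_
  · refine Summable.of_nonneg_of_le (fun n => norm_nonneg _) (fun n => ?_)
      ((summable_geometric_of_lt_one (norm_nonneg _) hx).mul_right C)
    rw [div_eq_mul_inv, norm_mul, zpow_natCast, norm_pow, zpow_natCast]
    gcongr; exact hb n
  · refine Summable.of_nonneg_of_le (fun n => norm_nonneg _) (fun n => ?_)
      ((summable_geometric_of_lt_one (norm_nonneg _) hqx').mul_right D)
    have e : x ^ (-(n : ℤ)) / (1 - a * q ^ (-(n : ℤ))) = (q / x) ^ n * (q ^ n - a)⁻¹ := by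
      rw [zpow_neg, zpow_neg, zpow_natCast, zpow_natCast]
      have := pow_ne_zero n hq0
      have := pow_ne_zero n hx0
      have e1 : 1 - a * (q ^ n)⁻¹ = (q ^ n - a) * (q ^ n)⁻¹ := by field_simp
      rw [e1, div_pow, div_eq_mul_inv, mul_inv, inv_inv]; field_simp
    rw [e, norm_mul, norm_pow]
    gcongr; exact hd n

lemma half_prod {q a y : ℂ} (hq0 : q ≠ 0) (ha : a ≠ 0) (hy : y ≠ 0) (N : ℕ) :
    ∏ j ∈ range (2 * N), (q ^ N / a - y * q ^ j) =
      ((∏ i ∈ range N, (-q ^ (N - 1 - i))) * (q ^ N / a) ^ N) * (y ^ N * (qPn (q / (a * y)) q N * qPn (a * y) q N)) := by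
  rcases Nat.eq_zero_or_pos N with rfl | hN
  · simp [qPn]
  rw [zpow_split_prod q (2 * N) N (by omega)]
  have e1 : ∀ i ∈ range N, q ^ N / a - y * q ^ (N - 1 - i) = (-q ^ (N - 1 - i)) * y * (1 - q / (a * y) * q ^ i) := by
    intro i hi
    rw [mem_range] at hi
    have : q ^ N = q ^ (N - 1 - i) * (q * q ^ i) := by
      rw [← pow_succ', ← pow_add]; congr 1; omega
    rw [this]; field_simp; ring
  have e2 : ∀ i ∈ range (2 * N - N), q ^ N / a - y * q ^ (N + i) = (q ^ N / a) * (1 - a * y * q ^ i) := by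
    intro i hi
    rw [pow_add]; field_simp
  rw [prod_congr rfl e1, prod_congr rfl e2, prod_mul_distrib, prod_mul_distrib, prod_mul_distrib]
  simp only [prod_const, card_range, qPn, show 2 * N - N = N by omega]
  ring

lemma finite_kron {q a x : ℂ} (hq0 : q ≠ 0) (hq : ‖q‖ < 1) (ha0 : a ≠ 0) (hx0 : x ≠ 0)
    (ha : ∀ n : ℤ, a * q ^ n ≠ 1) (N : ℕ) :
    qPn (q / (a * x)) q N * qPn (a * x) q N = qPn (q / a) q N * qPn a q N *
      (x ^ N + ∑ j ∈ range (2 * N), x ^ ((j : ℤ) - N) * cc x q (2 * N) j * (1 - a * q ^ ((j : ℤ) - N))⁻¹) := by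
  have ht : ∀ j ∈ range (2 * N), q ^ N / a ≠ q ^ j := by
    intro j _ h
    apply ha ((j : ℤ) - N)
    rw [zpow_sub₀ hq0, zpow_natCast, zpow_natCast, ← h]
    have := pow_ne_zero N hq0
    field_simp
  have h := partial_fraction hq0 hq hx0 (2 * N) ht
  rw [half_prod hq0 ha0 hx0] at h
  have h1 := half_prod hq0 ha0 one_ne_zero (y := 1) N
  simp only [one_mul, mul_one, one_pow] at h1
  rw [h1] at h
  have hc : ((∏ i ∈ range N, (-q ^ (N - 1 - i))) * (q ^ N / a) ^ N) ≠ 0 := by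
    apply mul_ne_zero
    · exact prod_ne_zero_iff.2 fun i _ => neg_ne_zero.2 (pow_ne_zero _ hq0)
    · exact pow_ne_zero _ (div_ne_zero (pow_ne_zero _ hq0) ha0)
  have h := mul_left_cancel₀ hc (h.trans (mul_assoc _ _ _))
  have hxN := pow_ne_zero N hx0
  apply mul_left_cancel₀ hxN
  rw [h, mul_left_comm (x ^ N)]
  congr 1
  rw [mul_add, mul_sum, ← pow_add, ← two_mul]
  congr 1
  refine sum_congr rfl fun j hj => ?_
  have e1 : x ^ ((j : ℤ) - N) = x ^ j / x ^ N := by rw [zpow_sub₀ hx0]; simp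
  have hd := zpow_ne_one_of_ne ha ((j : ℤ) - N)
  have e2 : q ^ ((j : ℤ) - N) = q ^ j / q ^ N := by rw [zpow_sub₀ hq0]; simp
  rw [e2] at hd
  rw [e1, e2]
  have hqN := pow_ne_zero N hq0
  have : q ^ N / a - q ^ j = (q ^ N / a) * (1 - a * (q ^ j / q ^ N)) := by field_simp
  rw [this]
  field_simp

open Filter in
theorem KK_prod {q a x : ℂ} (hq0 : q ≠ 0) (hq : ‖q‖ < 1) (ha0 : a ≠ 0)
    (hqx : ‖q‖ < ‖x‖) (hx : ‖x‖ < 1)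
    (ha : ∀ n : ℤ, a * q ^ n ≠ 1) :
    KK a x q * (th a q * th x q) = ee q ^ 2 * th (a * x) q := by
  have hx0 : x ≠ 0 := by
    rw [← norm_pos_iff]; exact (norm_nonneg q).trans_lt hqx
  have hs := KK_summable hq0 hq ha0 hqx hx
  have hne : ∀ i : ℕ, q * q ^ i ≠ 1 := pow_ne_one_of_norm hq
  let G : ℕ → ℤ → ℂ := fun N n => if -(N : ℤ) ≤ n ∧ n < N then
      x ^ n * cc x q (2 * N) (n + N).toNat * (1 - a * q ^ n)⁻¹ else 0
  have hG : ∀ N, ∑' n, G N n = ∑ j ∈ range (2 * N), x ^ ((j : ℤ) - N) * cc x q (2 * N) j * (1 - a * q ^ ((j : ℤ) - N))⁻¹ := by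
    intro N
    rw [tsum_eq_sum (s := Finset.Ico (-N : ℤ) N)]
    · symm
      refine Finset.sum_bij (fun j _ => (j : ℤ) - N) ?_ ?_ ?_ ?_
      · intro j hj; simp at hj ⊢; omega
      · intro a _ b _ h; simpa using h
      · intro b hb; simp at hb
        refine ⟨(b + N).toNat, ?_, ?_⟩
        · simp; omega
        · omega
      · intro j hj
        simp at hj
        have : -(N : ℤ) ≤ (j : ℤ) - N ∧ (j : ℤ) - N < N := by omega
        simp only [G, this]
        simp
    · intro n hn
      rw [Finset.mem_Ico] at hn
      simp only [G, hn, if_false]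
  obtain ⟨C1, hC1, hb1⟩ := qPn_bound (q / x) hq
  obtain ⟨C3, hC3, hb3⟩ := qPn_bound x hq
  obtain ⟨C2, hC2, hb2⟩ := qPn_inv_bound hq hne
  have hlim : Tendsto (fun N => ∑' n, G N n) atTop
      (nhds (∑' n : ℤ, x ^ n / (1 - a * q ^ n) * ((qP (q / x) q * qP x q) * ((qP q q)⁻¹ * (qP q q)⁻¹)))) := by
    refine tendsto_tsum_of_dominated_convergence
      (bound := fun n => ‖x ^ n / (1 - a * q ^ n)‖ * ((C1 * C3) * (C2 * C2)))
      (hs.mul_right _) ?_ ?_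
    · intro n
      have ev : ∀ᶠ N : ℕ in atTop, x ^ n / (1 - a * q ^ n) * ((qPn (q / x) q (n + N).toNat * qPn x q (N - n).toNat) *
          ((qPn q q (n + N).toNat)⁻¹ * (qPn q q (N - n - 1).toNat)⁻¹)) = G N n := by
        filter_upwards [eventually_ge_atTop (n.natAbs + 1)] with N hN
        have : -(N : ℤ) ≤ n ∧ n < N := by omega
        simp only [G, this, cc]
        rw [show 2 * N - (n + N).toNat = (N - n).toNat by omega,
          show 2 * N - 1 - (n + N).toNat = (N - n - 1).toNat by omega]
        simp only [and_self, if_true]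
        ring
      refine Tendsto.congr' ev ?_
      have t2 : Tendsto (fun N : ℕ => (n + N).toNat) atTop atTop :=
        tendsto_atTop_mono (f := fun N : ℕ => N - n.natAbs) (fun N => by omega) (tendsto_sub_atTop_nat _)
      have t3 : Tendsto (fun N : ℕ => ((N : ℤ) - n).toNat) atTop atTop :=
        tendsto_atTop_mono (f := fun N : ℕ => N - n.natAbs) (fun N => by omega) (tendsto_sub_atTop_nat _)
      have t4 : Tendsto (fun N : ℕ => ((N : ℤ) - n - 1).toNat) atTop atTop :=
        tendsto_atTop_mono (f := fun N : ℕ => N - (n.natAbs + 1)) (fun N => by omega) (tendsto_sub_atTop_nat _)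
      have T' := (qPn_tendsto q hq).inv₀ (qP_ne_zero hq hne)
      exact ((((qPn_tendsto _ hq).comp t2).mul ((qPn_tendsto _ hq).comp t3)).mul
        ((T'.comp t2).mul (T'.comp t4))).const_mul _
    · refine Eventually.of_forall fun N n => ?_
      by_cases h : -(N : ℤ) ≤ n ∧ n < N
      · simp only [G, h, and_self, if_true, cc]
        rw [mul_right_comm, ← div_eq_mul_inv, norm_mul]
        gcongr
        rw [norm_mul, norm_mul, norm_mul]
        gcongr <;> first | exact hb1 _ | exact hb2 _ | exact hb3 _
      · simp only [G, h, if_false, norm_zero]; positivity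
  have h1 := (((qPn_tendsto (q / a) hq).mul (qPn_tendsto a hq)).mul
    ((tendsto_pow_atTop_nhds_zero_of_norm_lt_one hx).add hlim))
  have h2 := (qPn_tendsto (q / (a * x)) hq).mul (qPn_tendsto (a * x) hq)
  have h3 := tendsto_nhds_unique h2 (h1.congr fun N => by rw [hG, ← finite_kron hq0 hq ha0 hx0 ha N])
  rw [tsum_mul_right] at h3
  have h4 := qP_ne_zero hq hne
  rw [th, th, th, mul_comm (qP (a * x) q), h3, ee, KK]
  field_simp
  ring


/-! ### Telescoping -/

lemma hasSum_of_eq {ι : Type*} {f g : ι → ℂ} {s t : ℂ} (h : HasSum f s) (hfg : ∀ n, f n = g n)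
    (hst : s = t) : HasSum g t := by
  have : f = g := funext hfg
  rw [← this, ← hst]; exact h

lemma hasSum_shift {f : ℤ → ℂ} {s : ℂ} (h : HasSum f s) (k : ℤ) : HasSum (fun n => f (n + k)) s :=
  (Equiv.addRight k).hasSum_iff.2 h

lemma summable_bounded_geo {u : ℕ → ℂ} {C : ℝ} {q y : ℂ} (hq : ‖q‖ < 1)
    (h : ∀ n, ‖u n‖ ≤ C) : Summable fun n : ℕ => ‖y * q ^ n * u n‖ := by
  refine Summable.of_nonneg_of_le (fun n => norm_nonneg _) (fun n => ?_)
    (((summable_geometric_of_lt_one (norm_nonneg _) hq).mul_left ‖y‖).mul_right C)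
  rw [norm_mul, norm_mul, norm_pow]
  gcongr; exact h n

lemma telescope_one {a q : ℂ} (hq0 : q ≠ 0) (hq : ‖q‖ < 1) (ha0 : a ≠ 0)
    (ha : ∀ n : ℤ, a * q ^ n ≠ 1) :
    HasSum (fun n : ℤ => (1 - a * q ^ n)⁻¹ - (1 - a * q ^ (n + 1))⁻¹) (-1) := by
  let c : ℤ → ℂ := fun n => if 0 ≤ n then 1 else 0
  let e : ℤ → ℂ := fun n => (1 - a * q ^ n)⁻¹ - c n
  have he : Summable e := by
    obtain ⟨C, hC, hb⟩ := inv_bound_pos (a := a) hq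
    obtain ⟨D, hD, hd⟩ := inv_bound_neg (a := a) hq ha0
    refine Summable.of_nat_of_neg_add_one ?_ ?_
    · refine (summable_bounded_geo (y := a) hq hb).of_norm.congr fun n => ?_
      have := zpow_ne_one_of_ne ha n
      rw [zpow_natCast] at this
      simp only [e, c, zpow_natCast, Int.natCast_nonneg, if_true]
      field_simp
      ring
    · refine (summable_bounded_geo (y := q) (u := fun n => (q ^ (n + 1) - a)⁻¹) hq (fun n => hd (n + 1))).of_norm.congr fun n => ?_
      have := zpow_ne_one_of_ne ha (-(n + 1 : ℕ))
      rw [zpow_neg, zpow_natCast] at this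
      have hn : ¬ (0 : ℤ) ≤ -(n + 1 : ℕ) := by omega
      have hn' : (-((n : ℤ) + 1)) = -((n + 1 : ℕ) : ℤ) := by push_cast; ring
      simp only [e, c, hn', hn, if_false, zpow_neg, zpow_natCast]
      have hqn := pow_ne_zero (n + 1) hq0
      have e1 : 1 - a * (q ^ (n + 1))⁻¹ = (q ^ (n + 1) - a) * (q ^ (n + 1))⁻¹ := by field_simp
      rw [e1, mul_inv, inv_inv]
      ring
  have h1 := he.hasSum.sub (hasSum_shift he.hasSum 1)
  have h2 : HasSum (fun n : ℤ => c n - c (n + 1)) (-1) := by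
    have : (fun n : ℤ => c n - c (n + 1)) = fun n => if n = -1 then -1 else 0 := by
      funext n
      simp only [c]
      split_ifs <;> first | omega | simp
    rw [this]
    exact hasSum_ite_eq _ _
  have h3 := h1.add h2
  refine hasSum_of_eq h3 (fun n => ?_) (by simp)
  simp only [e]; ring

lemma telescope {a q : ℂ} (hq0 : q ≠ 0) (hq : ‖q‖ < 1) (ha0 : a ≠ 0)
    (ha : ∀ n : ℤ, a * q ^ n ≠ 1) (k : ℤ) :
    HasSum (fun n : ℤ => (1 - a * q ^ n)⁻¹ - (1 - a * q ^ (n + k))⁻¹) (-k) := by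
  have h1 := telescope_one hq0 hq ha0 ha
  induction k with
  | zero => simpa using (hasSum_zero (α := ℂ) (β := ℤ))
  | succ k ih =>
    refine hasSum_of_eq (ih.add (hasSum_shift h1 k)) (fun n => ?_) (by push_cast; ring)
    rw [add_assoc n (k : ℤ) 1]; ring
  | pred k ih =>
    refine hasSum_of_eq (ih.sub (hasSum_shift h1 (-(k : ℤ) - 1))) (fun n => ?_) (by push_cast; ring)
    rw [show n + (-(k : ℤ) - 1) + 1 = n + -k by ring]; ring

lemma conv_sum {f g : ℤ → ℂ} (hf : Summable fun n => ‖f n‖) (hg : Summable fun n => ‖g n‖) :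
    (∀ k, Summable fun m => f (m + k) * g m) ∧
      HasSum (fun k => ∑' m, f (m + k) * g m) ((∑' n, f n) * (∑' n, g n)) := by
  have h := (summable_mul_of_summable_norm hf hg).hasSum
  rw [← tsum_mul_tsum_of_summable_norm hf hg] at h
  let e : ℤ × ℤ ≃ ℤ × ℤ :=
    { toFun := fun p => (p.2 + p.1, p.2)
      invFun := fun p => (p.1 - p.2, p.2)
      left_inv := fun p => by ext <;> simp
      right_inv := fun p => by ext <;> simp }
  have h' := e.hasSum_iff.2 h
  have hs : ∀ k, Summable fun m => f (m + k) * g m := fun k => h'.summable.prod_factor k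
  exact ⟨hs, h'.prod_fiberwise fun k => (hs k).hasSum⟩

/-! ### The Weierstrass-type function -/

/-- `u/(1-u)^2` -/
noncomputable def ff (u : ℂ) : ℂ := u / (1 - u) ^ 2

/-- third derivative analogue -/
noncomputable def f3 (u : ℂ) : ℂ := u * (1 + 4 * u + u ^ 2) / (1 - u) ^ 4

/-- bilateral sum of `ff` -/
noncomputable def FF (a q : ℂ) : ℂ := ∑' n : ℤ, ff (a * q ^ n)

/-- bilateral sum of `f3` -/
noncomputable def FF3 (a q : ℂ) : ℂ := ∑' n : ℤ, f3 (a * q ^ n)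

lemma ff_inv (u : ℂ) : ff u⁻¹ = ff u := by
  rcases eq_or_ne u 0 with rfl | h0
  · simp
  rcases eq_or_ne u 1 with rfl | h1
  · simp
  have : 1 - u ≠ 0 := sub_ne_zero.2 h1.symm
  have e : 1 - u⁻¹ = -(1 - u) * u⁻¹ := by field_simp; ring
  unfold ff
  rw [e]
  field_simp

lemma f3_eq (u : ℂ) : f3 u = 6 * ff u ^ 2 + ff u := by
  unfold f3 ff
  rcases eq_or_ne u 1 with rfl | h1
  · simp
  have : 1 - u ≠ 0 := sub_ne_zero.2 h1.symm
  field_simp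
  ring

lemma f3_inv (u : ℂ) : f3 u⁻¹ = f3 u := by
  rw [f3_eq, ff_inv, f3_eq]

lemma ff_summable_nat (y : ℂ) {q : ℂ} (hq : ‖q‖ < 1) : Summable fun n : ℕ => ‖ff (y * q ^ n)‖ := by
  obtain ⟨C, hC, hb⟩ := inv_bound_pos (a := y) hq
  refine (summable_bounded_geo (y := y) (u := fun n => ((1 - y * q ^ n)⁻¹) ^ 2) (C := C ^ 2) hq (fun n => ?_)).congr fun n => ?_
  · rw [norm_pow]; gcongr; exact hb n
  · rw [ff]; congr 1; rw [inv_pow, div_eq_mul_inv]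

lemma ff_neg_index {a q : ℂ} (n : ℕ) :
    ff (a * q ^ (-((n : ℤ) + 1))) = ff (q / a * q ^ n) := by
  rw [← ff_inv]
  congr 1
  rw [zpow_neg, mul_inv, inv_inv, show (n : ℤ) + 1 = ((n + 1 : ℕ) : ℤ) by push_cast; ring, zpow_natCast, pow_succ]
  ring

lemma ff_summable (a : ℂ) {q : ℂ} (hq : ‖q‖ < 1) : Summable fun n : ℤ => ‖ff (a * q ^ n)‖ := by
  refine Summable.of_nat_of_neg_add_one ?_ ?_
  · simpa using ff_summable_nat a hq
  · simpa only [ff_neg_index] using ff_summable_nat (q / a) hq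

theorem Pdiff {q a x : ℂ} (hq0 : q ≠ 0) (hq : ‖q‖ < 1) (ha0 : a ≠ 0)
    (hqx : ‖q‖ < ‖x‖) (hx : ‖x‖ < 1) (ha : ∀ n : ℤ, a * q ^ n ≠ 1) :
    HasSum (fun k : ℤ => k * x ^ k / (1 - q ^ k)) (FF a q - a * (KK a x q * KK a (q / x) q)) := by
  have hx0 : x ≠ 0 := by
    rw [← norm_pos_iff]; exact (norm_nonneg q).trans_lt hqx
  have hxp := norm_pos_iff.2 hx0
  have hqp := norm_pos_iff.2 hq0
  obtain ⟨hs, h⟩ := conv_sum (KK_summable hq0 hq ha0 hqx hx)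
    (KK_summable (x := q / x) hq0 hq ha0 (by
      rw [norm_div, lt_div_iff₀ hxp]; nlinarith) (by rw [norm_div]; exact (div_lt_one hxp).2 hqx))
  have hk : ∀ k : ℤ, ∑' m : ℤ, x ^ (m + k) / (1 - a * q ^ (m + k)) * ((q / x) ^ m / (1 - a * q ^ m))
      = (if k = 0 then FF a q / a else 0) - (k * x ^ k / (1 - q ^ k)) / a := by
    intro k
    rcases eq_or_ne k 0 with rfl | hk0
    · simp only [add_zero, if_true, Int.cast_zero, zero_mul, zero_div, sub_zero]
      rw [eq_div_iff ha0, ← tsum_mul_right, FF]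
      refine tsum_congr fun m => ?_
      have := zpow_ne_one_of_ne ha m
      rw [ff, div_zpow]
      have := zpow_ne_zero m hx0
      field_simp
    · have hqk : 1 - q ^ k ≠ 0 := by
        intro h0
        have h1 : ‖q‖ ^ k = 1 := by rw [← norm_zpow, ← sub_eq_zero.1 h0, norm_one]
        exact hk0 ((zpow_eq_one_iff_right₀ (norm_nonneg _) hq.ne).1 h1)
      have ht := (telescope hq0 hq ha0 ha k).mul_left (x ^ k / (a * (1 - q ^ k)))
      rw [(hasSum_of_eq ht (fun m => ?_) rfl).tsum_eq]
      · simp only [hk0, if_false]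
        field_simp; ring
      · have h1 := zpow_ne_one_of_ne ha m
        have h2 := zpow_ne_one_of_ne ha (m + k)
        rw [zpow_add₀ hq0, ← mul_assoc] at h2 ⊢
        rw [zpow_add₀ hx0, div_zpow]
        have := zpow_ne_zero m hx0
        generalize q ^ k = t at *
        generalize hs' : q ^ m = s at *
        have h3 : s * (1 - t) * a + (1 - a * s) = 1 - a * s * t := by ring
        rw [inv_eq_one_div, inv_eq_one_div, div_sub_div _ _ h1 h2, div_mul_div_comm, div_mul_div_comm,
          div_eq_div_iff (by simp [*]) (by simp [*])]
        field_simp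
        ring
  have h2 := (hasSum_ite_eq (0 : ℤ) (FF a q / a)).sub h
  refine hasSum_of_eq (h2.mul_left a) (fun k => ?_) ?_
  · rw [hk]; field_simp; ring
  · rw [KK, KK]; field_simp

lemma zpow_ne_one {q : ℂ} (hq : ‖q‖ < 1) {k : ℤ} (hk0 : k ≠ 0) : 1 - q ^ k ≠ 0 := by
  intro h0
  have h1 : ‖q‖ ^ k = 1 := by rw [← norm_zpow, ← sub_eq_zero.1 h0, norm_one]
  exact hk0 ((zpow_eq_one_iff_right₀ (norm_nonneg _) hq.ne).1 h1)

lemma f3_summable (a : ℂ) {q : ℂ} (hq : ‖q‖ < 1) : Summable fun n : ℤ => f3 (a * q ^ n) := by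
  have hF := ff_summable a hq
  have h := (conv_sum hF hF).1 0
  refine ((h.mul_left 6).add hF.of_norm).congr fun n => ?_
  rw [f3_eq, add_zero]; ring

lemma ff_alg {u t : ℂ} (h1 : 1 - u ≠ 0) (h2 : 1 - u * t ≠ 0) (h3 : 1 - t ≠ 0) :
    (ff u + ff (u * t)) * ff t + -(t * (1 + t) / (1 - t) ^ 3) * ((1 - u)⁻¹ - (1 - u * t)⁻¹) = ff (u * t) * ff u := by
  unfold ff
  generalize hA : 1 - u = A at *
  generalize hB : 1 - u * t = B at *
  generalize hD : 1 - t = D at *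
  field_simp
  subst hA hB hD
  ring

theorem ode {q : ℂ} (hq0 : q ≠ 0) (hq : ‖q‖ < 1) : ∃ C : ℂ, ∀ x : ℂ, x ≠ 0 →
    (∀ n : ℤ, x * q ^ n ≠ 1) →
    FF x q ^ 2 = (FF3 x q - FF x q) / 6 + 2 * FF x q * FF 1 q + C := by
  refine ⟨∑' k : ℤ, -(k : ℂ) * (-(q ^ k * (1 + q ^ k) / (1 - q ^ k) ^ 3)), fun x hx0 hx => ?_⟩
  have hF := ff_summable x hq
  obtain ⟨hs, h⟩ := conv_sum hF hF
  have hk : ∀ k : ℤ, ∑' m : ℤ, ff (x * q ^ (m + k)) * ff (x * q ^ m)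
      = (if k = 0 then (FF3 x q - FF x q) / 6 else 0) + 2 * FF x q * ff (1 * q ^ k) +
        -(k : ℂ) * (-(q ^ k * (1 + q ^ k) / (1 - q ^ k) ^ 3)) := by
    intro k
    rcases eq_or_ne k 0 with rfl | hk0
    · simp only [add_zero, if_true, Int.cast_zero, neg_zero, zero_mul, zpow_zero]
      rw [FF3, FF, ← (f3_summable x hq).tsum_sub hF.of_norm, ← tsum_div_const]
      simp only [f3_eq]
      rw [show ff (1 * 1) = 0 by simp [ff], mul_zero, add_zero]
      refine tsum_congr fun m => ?_
      ring
    · have hqk := zpow_ne_one hq hk0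
      have ht := (telescope hq0 hq hx0 hx k).mul_left (-(q ^ k * (1 + q ^ k) / (1 - q ^ k) ^ 3))
      have hFF := (hF.of_norm.hasSum.add (hasSum_shift hF.of_norm.hasSum k)).mul_right (ff (1 * q ^ k))
      rw [(hasSum_of_eq (hFF.add ht) (fun m => ?_) rfl).tsum_eq]
      · simp only [hk0, if_false, FF]
        ring
      · have h1 := zpow_ne_one_of_ne hx m
        have h2 := zpow_ne_one_of_ne hx (m + k)
        rw [zpow_add₀ hq0, ← mul_assoc] at h2 ⊢
        simp only [one_mul]
        exact ff_alg h1 h2 hqk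
  have h1 := (ff_summable 1 hq).of_norm.hasSum.mul_left (2 * FF x q)
  have h0 := hasSum_ite_eq (0 : ℤ) ((FF3 x q - FF x q) / 6)
  have h2 := h.sub (h0.add h1)
  have h3 := (hasSum_of_eq h2 (g := fun k : ℤ => -(k : ℂ) * (-(q ^ k * (1 + q ^ k) / (1 - q ^ k) ^ 3))) (fun k => by rw [hk]; ring) rfl).tsum_eq
  rw [show FF 1 q = ∑' n : ℤ, ff (1 * q ^ n) from rfl]
  rw [h3, FF]
  ring



/-! ### Lambert series -/

/-- Lambert series `∑ d^w x^d/(1-q^d)` -/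
noncomputable def Lam (w : ℕ) (x q : ℂ) : ℂ := ∑' d : ℕ, (d : ℂ) ^ w * x ^ d / (1 - q ^ d)

lemma Lam_summable (w : ℕ) {x q : ℂ} (hq : ‖q‖ < 1) (hx : ‖x‖ < 1) :
    Summable fun d : ℕ => ‖(d : ℂ) ^ w * x ^ d / (1 - q ^ d)‖ := by
  obtain ⟨C, hC, hb⟩ := inv_bound_pos (a := 1) hq
  refine Summable.of_nonneg_of_le (fun n => norm_nonneg _) (fun n => ?_)
    ((summable_norm_pow_mul_geometric_of_norm_lt_one w hx).mul_right C)
  rw [div_eq_mul_inv, norm_mul]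
  gcongr
  simpa using hb n

lemma hasSum_ff {u : ℂ} (hu : ‖u‖ < 1) : HasSum (fun d : ℕ => (d : ℂ) ^ 1 * u ^ d) (ff u) := by
  simpa [ff] using hasSum_coe_mul_geometric_of_norm_lt_one hu

lemma hasSum_f3 {u : ℂ} (hu : ‖u‖ < 1) : HasSum (fun d : ℕ => (d : ℂ) ^ 3 * u ^ d) (f3 u) := by
  have h3 := (hasSum_choose_mul_geometric_of_norm_lt_one 3 hu).mul_left 6
  have h2 := (hasSum_choose_mul_geometric_of_norm_lt_one 2 hu).mul_left 12
  have h1 := (hasSum_choose_mul_geometric_of_norm_lt_one 1 hu).mul_left 7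
  have h0 := (hasSum_choose_mul_geometric_of_norm_lt_one 0 hu)
  have h10 : 1 - u ≠ 0 := by
    intro h; rw [← sub_eq_zero.1 h] at hu; simp at hu
  refine hasSum_of_eq (((h3.sub h2).add h1).sub h0) (fun d => ?_) ?_
  · have c3 : (((d + 3).choose 3 : ℕ) : ℂ) = (d + 1) * (d + 2) * (d + 3) / 6 := by
      rw [Nat.cast_choose_eq_ascPochhammer_div]
      simp [ascPochhammer_eval_succ, ascPochhammer, Nat.factorial]
      ring
    have c2 : (((d + 2).choose 2 : ℕ) : ℂ) = (d + 1) * (d + 2) / 2 := by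
      rw [Nat.cast_choose_eq_ascPochhammer_div]
      simp [ascPochhammer_eval_succ, ascPochhammer, Nat.factorial]
      exact Or.inl (by ring)
    rw [c3, c2, Nat.choose_one_right, Nat.choose_zero_right]
    push_cast
    ring
  · rw [f3]; field_simp; ring

lemma pos_half {w : ℕ} (hw : w ≠ 0) {g : ℂ → ℂ}
    (hg : ∀ u : ℂ, ‖u‖ < 1 → HasSum (fun d : ℕ => (d : ℂ) ^ w * u ^ d) (g u))
    {x q : ℂ} (hq : ‖q‖ < 1) (hx : ‖x‖ < 1) :
    HasSum (fun n : ℕ => g (x * q ^ n)) (Lam w x q) := by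
  have geo : ∀ (q : ℂ) (d : ℕ), ‖q‖ < 1 → ∀ x : ℂ, HasSum (fun n : ℕ => (d : ℂ) ^ w * (x * q ^ n) ^ d) ((d : ℂ) ^ w * x ^ d / (1 - q ^ d)) := by
    intro q d hq x
    rcases Nat.eq_zero_or_pos d with rfl | hd
    · simpa [hw] using (hasSum_zero (α := ℂ) (β := ℕ))
    · have h := (hasSum_geometric_of_norm_lt_one (norm_pow_lt hq hd.ne')).mul_left ((d : ℂ) ^ w * x ^ d)
      refine hasSum_of_eq h (fun n => ?_) (by rw [div_eq_mul_inv])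
      rw [mul_pow, ← pow_mul, ← pow_mul, mul_comm n d]; ring
  have hs : Summable fun p : ℕ × ℕ => (p.1 : ℂ) ^ w * (x * q ^ p.2) ^ p.1 := by
    apply Summable.of_norm
    rw [summable_prod_of_nonneg (fun _ => norm_nonneg _)]
    constructor
    · intro d
      exact (geo q d hq x).summable.norm
    · have hq' : ‖((‖q‖ : ℝ) : ℂ)‖ < 1 := by simpa using hq
      have hx' : ‖((‖x‖ : ℝ) : ℂ)‖ < 1 := by simpa using hx
      refine (Lam_summable w hq' hx').congr fun d => ?_
      have h := geo (‖q‖ : ℝ) d hq' (‖x‖ : ℝ)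
      have h2 : HasSum (fun n : ℕ => ‖(d : ℂ) ^ w * (x * q ^ n) ^ d‖) ((d : ℝ) ^ w * ‖x‖ ^ d / (1 - ‖q‖ ^ d)) := by
        rw [← Complex.hasSum_ofReal]
        push_cast at h ⊢
        refine hasSum_of_eq h (fun n => ?_) rfl
        simp
      rw [h2.tsum_eq]
      have : 0 ≤ (d : ℝ) ^ w * ‖x‖ ^ d / (1 - ‖q‖ ^ d) := by
        rw [← h2.tsum_eq]; exact tsum_nonneg fun _ => norm_nonneg _
      rw [← abs_of_nonneg this, ← Real.norm_eq_abs, ← Complex.norm_real]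
      push_cast
      rfl
  have h1 := hs.hasSum.prod_fiberwise fun d => geo q d hq x
  have h2 := ((Equiv.prodComm ℕ ℕ).hasSum_iff.2 hs.hasSum).prod_fiberwise (g := fun n => g (x * q ^ n)) fun n => by
    refine hg (x * q ^ n) ?_
    rw [norm_mul, norm_pow]
    calc ‖x‖ * ‖q‖ ^ n ≤ ‖x‖ * 1 := by gcongr; exact pow_le_one₀ (norm_nonneg _) hq.le
      _ < 1 := by simpa
  rw [Lam, h1.tsum_eq]
  exact h2

lemma f3_neg_index {a q : ℂ} (n : ℕ) :
    f3 (a * q ^ (-((n : ℤ) + 1))) = f3 (q / a * q ^ n) := by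
  rw [f3_eq, f3_eq, ff_neg_index]

lemma FF_hasSum {x q : ℂ} (hq : ‖q‖ < 1) (hx : ‖x‖ < 1) (hqx : ‖q / x‖ < 1) :
    FF x q = Lam 1 x q + Lam 1 (q / x) q := by
  refine (HasSum.of_nat_of_neg_add_one ?_ ?_).tsum_eq
  · simpa using pos_half one_ne_zero (fun u hu => hasSum_ff hu) hq hx
  · simpa only [ff_neg_index] using pos_half one_ne_zero (fun u hu => hasSum_ff hu) hq hqx

lemma FF3_hasSum {x q : ℂ} (hq : ‖q‖ < 1) (hx : ‖x‖ < 1) (hqx : ‖q / x‖ < 1) :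
    FF3 x q = Lam 3 x q + Lam 3 (q / x) q := by
  refine (HasSum.of_nat_of_neg_add_one ?_ ?_).tsum_eq
  · simpa using pos_half three_ne_zero (fun u hu => hasSum_f3 hu) hq hx
  · simpa only [f3_neg_index] using pos_half three_ne_zero (fun u hu => hasSum_f3 hu) hq hqx

lemma FF_unit {x q : ℂ} (hq : ‖q‖ < 1) (hx : ‖x‖ = 1) :
    FF x q = ff x + Lam 1 (x * q) q + Lam 1 (q / x) q := by
  refine (HasSum.of_nat_of_neg_add_one ?_ ?_).tsum_eq
  · have h := pos_half one_ne_zero (fun u hu => hasSum_ff hu) hq (x := x * q) (by rw [norm_mul, hx, one_mul]; exact hq)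
    rw [add_comm, ← hasSum_nat_add_iff' 1]
    refine hasSum_of_eq h (fun n => ?_) ?_
    · push_cast
      rw [show ((n : ℤ) + 1) = ((n + 1 : ℕ) : ℤ) by push_cast; ring, zpow_natCast, pow_succ']
      congr 1; ring
    · simp
  · simpa only [ff_neg_index] using pos_half one_ne_zero (fun u hu => hasSum_ff hu) hq
      (x := q / x) (by rw [norm_div, hx, div_one]; exact hq)

/-- `∑ d q^d/(1-q^d)` -/
noncomputable def SS (q : ℂ) : ℂ := Lam 1 q q

lemma FF_one {q : ℂ} (hq : ‖q‖ < 1) : FF 1 q = 2 * SS q := by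
  rw [FF_unit hq (by simp), SS]; simp [ff]; ring

lemma FF_neg_one {q : ℂ} (hq : ‖q‖ < 1) : FF (-1) q = -1 / 4 + 2 * Lam 1 (-q) q := by
  rw [FF_unit hq (by simp)]; simp [ff]; norm_num; ring

theorem FF3_diff {q x y : ℂ} (hq0 : q ≠ 0) (hq : ‖q‖ < 1) (hx0 : x ≠ 0) (hy0 : y ≠ 0)
    (hx : ∀ n : ℤ, x * q ^ n ≠ 1) (hy : ∀ n : ℤ, y * q ^ n ≠ 1) :
    FF3 x q - FF3 y q = (FF x q - FF y q) * (6 * (FF x q + FF y q) + 1 - 24 * SS q) := by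
  obtain ⟨C, hC⟩ := ode hq0 hq
  have h1 := hC x hx0 hx
  have h2 := hC y hy0 hy
  rw [FF_one hq] at h1 h2
  linear_combination (-6) * h1 + 6 * h2

lemma FF_Lambert_Z {q x : ℂ} (hq0 : q ≠ 0) (hq : ‖q‖ < 1) (hqx : ‖q‖ < ‖x‖) (hx : ‖x‖ < 1) :
    HasSum (fun k : ℤ => k * x ^ k / (1 - q ^ k)) (FF x q) := by
  have hx0 : x ≠ 0 := by
    rw [← norm_pos_iff]; exact (norm_nonneg q).trans_lt hqx
  have hqx' : ‖q / x‖ < 1 := by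
    rw [norm_div]; exact (div_lt_one (norm_pos_iff.2 hx0)).2 hqx
  rw [FF_hasSum hq hx hqx']
  refine HasSum.of_nat_of_neg_add_one ?_ ?_
  · simpa [Lam] using (Lam_summable 1 hq hx).of_norm.hasSum
  · have h := (Lam_summable 1 hq hqx').of_norm.hasSum
    rw [← hasSum_nat_add_iff' 1] at h
    refine hasSum_of_eq h (fun n => ?_) (by simp [Lam])
    rw [show -((n : ℤ) + 1) = -((n + 1 : ℕ) : ℤ) by push_cast; ring, zpow_neg, zpow_neg, zpow_natCast, zpow_natCast, div_pow]
    have h1 := zpow_ne_one hq (k := ((n + 1 : ℕ) : ℤ)) (by positivity)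
    rw [zpow_natCast] at h1
    have h2 := pow_ne_zero (n + 1) hq0
    have h3 := pow_ne_zero (n + 1) hx0
    generalize q ^ (n + 1) = Q at *
    have h4 : 1 - Q⁻¹ = -(1 - Q) * Q⁻¹ := by field_simp; ring
    rw [h4]
    push_cast
    field_simp

lemma th_div (x : ℂ) {q : ℂ} (hq0 : q ≠ 0) : th (q / x) q = th x q := by
  rw [th, th, mul_comm]; congr 2; field_simp

theorem FF_diff {q a x : ℂ} (hq0 : q ≠ 0) (hq : ‖q‖ < 1) (ha0 : a ≠ 0)
    (hqx : ‖q‖ < ‖x‖) (hx : ‖x‖ < 1) (ha : ∀ n : ℤ, a * q ^ n ≠ 1) :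
    (FF a q - FF x q) * (th a q * th x q) ^ 2 = a * ee q ^ 4 * (th (a * x) q * th (a * (q / x)) q) := by
  have hx0 : x ≠ 0 := by
    rw [← norm_pos_iff]; exact (norm_nonneg q).trans_lt hqx
  have hxp := norm_pos_iff.2 hx0
  have hqp := norm_pos_iff.2 hq0
  have h := (Pdiff hq0 hq ha0 hqx hx ha).unique (FF_Lambert_Z hq0 hq hqx hx)
  have h1 := KK_prod hq0 hq ha0 hqx hx ha
  have h2 := KK_prod (x := q / x) hq0 hq ha0 (by
      rw [norm_div, lt_div_iff₀ hxp]; nlinarith) (by rw [norm_div]; exact (div_lt_one hxp).2 hqx) ha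
  rw [th_div x hq0] at h2
  rw [← h]
  linear_combination a * KK a (q / x) q * (th a q * th x q) * h1 + a * ee q ^ 2 * th (a * x) q * h2


lemma even_only {f : ℕ → ℂ} {s : ℂ} (ho : ∀ k, f (2 * k + 1) = 0)
    (h : HasSum (fun k => f (2 * k)) s) : HasSum f s := by
  have hinj : Function.Injective (fun k : ℕ => 2 * k) := fun a b h => by simpa using h
  refine (hinj.hasSum_iff ?_).1 h
  intro n hn
  rcases Nat.even_or_odd' n with ⟨k, rfl | rfl⟩
  · exact absurd ⟨k, rfl⟩ hn
  · exact ho k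

lemma npow_ne_one {q : ℂ} (hq : ‖q‖ < 1) {d : ℕ} (hd : d ≠ 0) : 1 - q ^ d ≠ 0 := by
  have := zpow_ne_one hq (k := d) (by exact_mod_cast hd)
  rwa [zpow_natCast] at this

lemma Lam_has (w : ℕ) {x q : ℂ} (hq : ‖q‖ < 1) (hx : ‖x‖ < 1) :
    HasSum (fun d : ℕ => (d : ℂ) ^ w * x ^ d / (1 - q ^ d)) (Lam w x q) :=
  (Lam_summable w hq hx).of_norm.hasSum

lemma SS_has {q : ℂ} (hq : ‖q‖ < 1) :
    HasSum (fun d : ℕ => (d : ℂ) * q ^ d / (1 - q ^ d)) (SS q) := by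
  simpa [SS] using Lam_has 1 hq hq

lemma Lam_odd {q : ℂ} (hq : ‖q‖ < 1) : Lam 1 q (q ^ 2) = SS q - SS (q ^ 2) := by
  refine (Lam_has 1 (norm_sq_lt hq) hq).unique
    (hasSum_of_eq ((SS_has hq).sub (SS_has (norm_sq_lt hq))) (fun d => ?_) rfl)
  rcases Nat.eq_zero_or_pos d with rfl | hd
  · simp
  have h1 := npow_ne_one hq hd.ne'
  have h2 := npow_ne_one (norm_sq_lt hq) hd.ne'
  simp only [← pow_mul, mul_comm _ d] at *
  simp only [pow_mul] at *
  generalize q ^ d = Q at *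
  field_simp
  ring

lemma Lam_neg {q : ℂ} (hq : ‖q‖ < 1) : Lam 1 (-q) q = 4 * SS (q ^ 2) - SS q := by
  have h1 : HasSum (fun d : ℕ => (d : ℂ) ^ 1 * (-q) ^ d / (1 - q ^ d) + (d : ℂ) * q ^ d / (1 - q ^ d)) (4 * SS (q ^ 2)) := by
    refine even_only (fun k => ?_) (hasSum_of_eq ((SS_has (norm_sq_lt hq)).mul_left 4) (fun k => ?_) rfl)
    · rw [Odd.neg_pow ⟨k, rfl⟩]; ring
    · rw [Even.neg_pow ⟨k, by ring⟩, pow_mul]; push_cast; ring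
  have h2 := h1.unique ((Lam_has 1 hq (by simpa using hq)).add (SS_has hq))
  rw [h2]; ring

lemma SS_add_neg {q : ℂ} (hq : ‖q‖ < 1) : SS q + SS (-q) = 6 * SS (q ^ 2) - 4 * SS (q ^ 4) := by
  have hq' : ‖-q‖ < 1 := by simpa using hq
  have h1 : HasSum (fun d : ℕ => (d : ℂ) * q ^ d / (1 - q ^ d) + (d : ℂ) * (-q) ^ d / (1 - (-q) ^ d)
      - 2 * ((d : ℂ) * (q ^ 2) ^ d / (1 - (q ^ 2) ^ d))) (4 * SS (q ^ 2) - 4 * SS (q ^ 4)) := by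
    refine even_only (fun k => ?_) (hasSum_of_eq (((SS_has (norm_sq_lt hq)).mul_left 4).sub
      ((SS_has (norm_pow_lt hq (k := 4) (by norm_num))).mul_left 4)) (fun k => ?_) rfl)
    · have h1 := npow_ne_one hq (d := 2 * k + 1) (by omega)
      have h2 := npow_ne_one hq' (d := 2 * k + 1) (by omega)
      have h3 := npow_ne_one (norm_sq_lt hq) (d := 2 * k + 1) (by omega)
      rw [Odd.neg_pow ⟨k, rfl⟩] at *
      rw [← pow_mul, mul_comm 2 (2 * k + 1), pow_mul] at *
      generalize q ^ (2 * k + 1) = Q at *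
      field_simp
      ring
    · rw [Even.neg_pow ⟨k, by ring⟩]
      rw [← pow_mul q 2 (2 * k), ← pow_mul q 2 k, ← pow_mul q 4 k, show 2 * (2 * k) = 4 * k by ring]; push_cast; ring
  have h2 := h1.unique (((SS_has hq).add (SS_has hq')).sub ((SS_has (norm_sq_lt hq)).mul_left 2))
  linear_combination -h2

lemma zpow_ne_one' {q : ℂ} (hq : ‖q‖ < 1) {k : ℤ} (hk0 : k ≠ 0) : q ^ k ≠ 1 :=
  fun h => zpow_ne_one hq hk0 (by rw [h, sub_self])

theorem phi_four {q : ℂ} (hq0 : q ≠ 0) (hq : ‖q‖ < 1) :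
    phi q ^ 4 = 1 + 8 * SS q - 32 * SS (q ^ 4) := by
  have hQ := norm_sq_lt hq
  have hQ0 := pow_ne_zero 2 hq0
  have hn := norm_pos_iff.2 hq0
  have h := FF_diff hQ0 hQ (a := -1) (x := q) (by simp) (by rw [norm_pow]; nlinarith) hq (by
    intro n hn
    rcases eq_or_ne n 0 with rfl | h0
    · norm_num at hn
    · have h1 := congrArg norm hn
      rw [norm_mul, norm_neg, norm_one, one_mul, norm_zpow] at h1
      exact h0 ((zpow_eq_one_iff_right₀ (norm_nonneg _) hQ.ne).1 h1))
  rw [FF_neg_one hQ, FF_hasSum hQ hq (by rw [pow_two, mul_div_assoc, div_self hq0, mul_one]; exact hq),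
    Lam_neg hQ] at h
  simp only [th] at h
  rw [qP_shift (-1) hQ] at h
  rw [show q ^ 2 / q = q by field_simp, show -1 * q ^ 2 = -q ^ 2 by ring, show q ^ 2 / (-1) = -q ^ 2 by ring,
    show -1 * q = -q by ring, show q ^ 2 / (-q) = -q by field_simp, qP_neg_self hQ, qP_odd hq, qP_neg_odd hq,
    Lam_odd hq, ← pow_mul] at h
  rw [phi_prod hq0 hq]
  have h1 := ee_ne_zero hq
  have h2 := ee_ne_zero (norm_sq_lt hq)
  have h4 := ee_ne_zero (norm_pow_lt hq (k := 4) (by norm_num))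
  norm_num at h
  field_simp at h ⊢
  linear_combination (1 / 4) * h

lemma phi_four_neg {q : ℂ} (hq0 : q ≠ 0) (hq : ‖q‖ < 1) :
    1 + 24 * SS (q ^ 2) - 48 * SS (q ^ 4) = (phi q ^ 4 + phi (-q) ^ 4) / 2 := by
  have h1 := phi_four hq0 hq
  have h2 := phi_four (q := -q) (by simpa using hq0) (by simpa using hq)
  rw [show (-q) ^ 4 = q ^ 4 by ring] at h2
  rw [h1, h2]
  linear_combination (-4) * SS_add_neg hq

lemma phi_neg_sq_four {q : ℂ} (hq0 : q ≠ 0) (hq : ‖q‖ < 1) :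
    phi (-q ^ 2) ^ 4 = phi q ^ 2 * (2 * phi (q ^ 2) ^ 2 - phi q ^ 2) := by
  have h1 := phi_neg_sq (pow_ne_zero 2 hq0) (norm_sq_lt hq)
  have h := phi_rel hq0 hq
  rw [← pow_mul] at h1
  norm_num at h1
  rw [show phi (-q ^ 2) ^ 4 = (phi (-q ^ 2) ^ 2) ^ 2 by ring, h1]
  grind

/-! ### First Eisenstein series -/

lemma V1 {q : ℂ} (hq0 : q ≠ 0) (hq : ‖q‖ < 1) :
    FF q (q ^ 8) - FF (q ^ 3) (q ^ 8) = phi q * phi (q ^ 2) * (phi q ^ 2 - phi (q ^ 2) ^ 2) / 4 := by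
  have hQ := norm_pow_lt hq (k := 8) (by norm_num)
  have hQ0 := pow_ne_zero 8 hq0
  have hn := norm_pos_iff.2 hq0
  have hq2 := norm_sq_lt hq
  have hq4 := norm_pow_lt hq (k := 4) (by norm_num)
  have h := FF_diff hQ0 hQ (a := q) (x := q ^ 3) hq0 (by
    rw [norm_pow, norm_pow]; exact pow_lt_pow_right_of_lt_one₀ hn hq (by norm_num))
    (norm_pow_lt hq (by norm_num)) (by
    intro n
    rw [← zpow_natCast, ← zpow_mul, ← zpow_one_add₀ hq0]
    exact zpow_ne_one' hq (by push_cast; omega))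
  simp only [th] at h
  have s1 := qP_split q hq2
  have s2 := qP_split q hq4
  have s3 := qP_split (q * q ^ 2) hq4
  have s4 := qP_split (q ^ 2) hq4
  rw [show q * q ^ 2 * q ^ 4 = q ^ 7 by ring, show q * q ^ 2 = q ^ 3 by ring, ← pow_mul] at s3
  rw [show q * q ^ 4 = q ^ 5 by ring, ← pow_mul] at s2
  rw [show q * q ^ 2 = q ^ 3 by ring, ← pow_mul] at s1
  rw [show q ^ 2 * q ^ 4 = q ^ 6 by ring, ← pow_mul] at s4
  norm_num at s1 s2 s3 s4
  have o1 := qP_odd hq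
  have o2 := qP_odd hq2
  have o4 := qP_odd hq4
  rw [← pow_mul] at o2 o4
  norm_num at o2 o4
  rw [show q ^ 8 / q = q ^ 7 by field_simp, show q ^ 8 / q ^ 3 = q ^ 5 by field_simp,
    show q * q ^ 3 = q ^ 4 by ring, show q * q ^ 5 = q ^ 6 by ring, show q ^ 8 / q ^ 4 = q ^ 4 by field_simp,
    show q ^ 8 / q ^ 6 = q ^ 2 by field_simp, o4] at h
  have e1 : qP q (q ^ 8) * qP (q ^ 7) (q ^ 8) * (qP (q ^ 3) (q ^ 8) * qP (q ^ 5) (q ^ 8)) = ee q / ee (q ^ 2) := by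
    rw [← o1, s1, s2, s3]; ring
  have e2 : qP (q ^ 6) (q ^ 8) * qP (q ^ 2) (q ^ 8) = ee (q ^ 2) / ee (q ^ 4) := by
    rw [← o2, s4]; ring
  rw [e1, e2] at h
  have p1 := phi_prod hq0 hq
  have p2 := phi_prod (pow_ne_zero 2 hq0) hq2
  have p3 := phi_sq_sub hq0 hq
  rw [← pow_mul, ← pow_mul] at p2
  norm_num at p2
  rw [p3, p1, p2]
  have h1 := ee_ne_zero hq
  have h2 := ee_ne_zero hq2
  have h4 := ee_ne_zero hq4
  have h8 := ee_ne_zero hQ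
  field_simp at h ⊢
  linear_combination h

lemma V2a {q : ℂ} (hq0 : q ≠ 0) (hq : ‖q‖ < 1) :
    FF q (q ^ 8) + FF (q ^ 3) (q ^ 8) = SS q - SS (q ^ 2) := by
  have hQ := norm_pow_lt hq (k := 8) (by norm_num)
  rw [← Lam_odd hq, FF_hasSum hQ hq (by rw [show q ^ 8 / q = q ^ 7 by field_simp]; exact norm_pow_lt hq (by norm_num)),
    FF_hasSum hQ (norm_pow_lt hq (by norm_num)) (by rw [show q ^ 8 / q ^ 3 = q ^ 5 by field_simp]; exact norm_pow_lt hq (by norm_num)),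
    show q ^ 8 / q = q ^ 7 by field_simp, show q ^ 8 / q ^ 3 = q ^ 5 by field_simp]
  refine (((Lam_has 1 hQ hq).add (Lam_has 1 hQ (norm_pow_lt hq (by norm_num)))).add
    ((Lam_has 1 hQ (norm_pow_lt hq (by norm_num))).add (Lam_has 1 hQ (norm_pow_lt hq (by norm_num))))).unique
    (hasSum_of_eq (Lam_has 1 (norm_sq_lt hq) hq) (fun d => ?_) rfl)
  rcases Nat.eq_zero_or_pos d with rfl | hd
  · simp
  have h1 := npow_ne_one (norm_sq_lt hq) hd.ne'
  have h2 := npow_ne_one hQ hd.ne'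
  simp only [← pow_mul, mul_comm _ d] at *
  simp only [pow_mul] at *
  generalize q ^ d = Q at *
  field_simp
  ring

theorem E1_formula {q : ℂ} (hq0 : q ≠ 0) (hq : ‖q‖ < 1) :
    Lam 3 q (q ^ 8) + Lam 3 (q ^ 7) (q ^ 8) - (Lam 3 (q ^ 3) (q ^ 8) + Lam 3 (q ^ 5) (q ^ 8)) =
      phi q * phi (q ^ 2) * (phi q ^ 2 - phi (q ^ 2) ^ 2) / 4 *
      (3 / 4 * (phi q ^ 4 - phi (q ^ 2) ^ 4) +
        (phi (q ^ 2) ^ 4 + phi q ^ 2 * (2 * phi (q ^ 2) ^ 2 - phi q ^ 2)) / 2) := by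
  have hQ := norm_pow_lt hq (k := 8) (by norm_num)
  have h1 := FF3_hasSum (x := q) hQ hq (by rw [show q ^ 8 / q = q ^ 7 by field_simp]; exact norm_pow_lt hq (by norm_num))
  have h2 := FF3_hasSum (x := q ^ 3) hQ (norm_pow_lt hq (by norm_num)) (by rw [show q ^ 8 / q ^ 3 = q ^ 5 by field_simp]; exact norm_pow_lt hq (by norm_num))
  rw [show q ^ 8 / q = q ^ 7 by field_simp] at h1
  rw [show q ^ 8 / q ^ 3 = q ^ 5 by field_simp] at h2
  rw [← h1, ← h2, FF3_diff (pow_ne_zero 8 hq0) hQ hq0 (pow_ne_zero 3 hq0) (by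
    intro n
    rw [← zpow_natCast, ← zpow_mul, ← zpow_one_add₀ hq0]
    exact zpow_ne_one' hq (by push_cast; omega)) (by
    intro n
    rw [← zpow_natCast, ← zpow_natCast, ← zpow_mul, ← zpow_add₀ hq0]
    exact zpow_ne_one' hq (by push_cast; omega)), V1 hq0 hq, V2a hq0 hq]
  congr 1
  have j1 := phi_four hq0 hq
  have j2 := phi_four (pow_ne_zero 2 hq0) (norm_sq_lt hq)
  have j3 := phi_four_neg (pow_ne_zero 2 hq0) (norm_sq_lt hq)
  rw [phi_neg_sq_four hq0 hq] at j3
  simp only [← pow_mul] at j2 j3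
  norm_num at j2 j3
  linear_combination (-3/4) * j1 + 3/4 * j2 + j3


/-- the character mod 8, complex-valued on naturals -/
noncomputable def ch (d : ℕ) : ℂ := ((ZMod.χ₈ (d : ZMod 8) : ℤ) : ℂ)

lemma ch_omega {ζ : ℂ} (hζ : ζ ^ 4 = -1) (d : ℕ) :
    ch d * (2 * ζ * (1 - ζ ^ 2)) = ζ ^ d + (ζ ^ 7) ^ d - ((ζ ^ 3) ^ d + (ζ ^ 5) ^ d) := by
  have h8 : ζ ^ 8 = 1 := by rw [show ζ ^ 8 = (ζ ^ 4) ^ 2 by ring, hζ]; norm_num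
  have hd : ((d : ℕ) : ZMod 8) = ((d % 8 : ℕ) : ZMod 8) := by simp
  have e : ∀ k : ℕ, (ζ ^ k) ^ d = (ζ ^ k) ^ (d % 8) := by
    intro k
    conv_lhs => rw [← Nat.div_add_mod d 8]
    rw [pow_add, pow_mul, ← pow_mul ζ k 8, mul_comm k 8, pow_mul ζ 8 k, h8]; simp
  have e1 := e 1
  rw [pow_one] at e1
  rw [e1, e 7, e 3, e 5, ch, hd]
  have h5 : ζ ^ 5 = -ζ := by linear_combination ζ * hζ
  have h7 : ζ ^ 7 = -ζ ^ 3 := by linear_combination ζ ^ 3 * hζ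
  rw [h5, h7]
  have hlt : d % 8 < 8 := Nat.mod_lt _ (by norm_num)
  generalize d % 8 = r at *
  have c0 : ZMod.χ₈ 0 = 0 := by decide
  have c1 : ZMod.χ₈ 1 = 1 := by decide
  have c2 : ZMod.χ₈ 2 = 0 := by decide
  have c3 : ZMod.χ₈ 3 = -1 := by decide
  have c4 : ZMod.χ₈ 4 = 0 := by decide
  have c5 : ZMod.χ₈ 5 = -1 := by decide
  have c6 : ZMod.χ₈ 6 = 0 := by decide
  have c7 : ZMod.χ₈ 7 = 1 := by decide
  interval_cases r <;>
    simp only [Nat.cast_zero, Nat.cast_one, Nat.cast_ofNat, c0, c1, c2, c3, c4, c5, c6, c7] <;>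
    push_cast <;> grind

lemma ch_sum {ζ : ℂ} (hζ : ζ ^ 4 = -1) (e : ℕ) :
    ζ ^ (4 * e) + (ζ ^ 7) ^ (4 * e) + ((ζ ^ 3) ^ (4 * e) + (ζ ^ 5) ^ (4 * e)) = 4 * (-1) ^ e := by
  simp only [← pow_mul]
  rw [show 7 * (4 * e) = 4 * (7 * e) by ring, show 3 * (4 * e) = 4 * (3 * e) by ring,
    show 5 * (4 * e) = 4 * (5 * e) by ring]
  simp only [pow_mul, hζ]
  norm_num
  ring

lemma ch_sum0 {ζ : ℂ} (hζ : ζ ^ 4 = -1) (d : ℕ) (hd : ¬ 4 ∣ d) :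
    ζ ^ d + (ζ ^ 7) ^ d + ((ζ ^ 3) ^ d + (ζ ^ 5) ^ d) = 0 := by
  have h5 : ζ ^ 5 = -ζ := by linear_combination ζ * hζ
  have h7 : ζ ^ 7 = -ζ ^ 3 := by linear_combination ζ ^ 3 * hζ
  rw [h5, h7]
  rcases Nat.even_or_odd' d with ⟨k, rfl | rfl⟩
  · obtain ⟨j, rfl⟩ : ∃ j, k = 2 * j + 1 := ⟨(k - 1) / 2, by omega⟩
    have : (ζ ^ 3) ^ (2 * (2 * j + 1)) = - ζ ^ (2 * (2 * j + 1)) := by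
      rw [← pow_mul, show 3 * (2 * (2 * j + 1)) = 2 * (2 * j + 1) + 4 * (2 * j + 1) by ring, pow_add, pow_mul ζ 4, hζ,
        Odd.neg_pow ⟨j, rfl⟩]; simp
    rw [Even.neg_pow ⟨2 * j + 1, by ring⟩, Even.neg_pow ⟨2 * j + 1, by ring⟩, this]; ring
  · rw [Odd.neg_pow ⟨k, rfl⟩, Odd.neg_pow ⟨k, rfl⟩]; ring

lemma exists_zeta : ∃ ζ : ℂ, ζ ^ 4 = -1 ∧ ‖ζ‖ = 1 ∧ 2 * ζ * (1 - ζ ^ 2) ≠ 0 := by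
  obtain ⟨ζ, hζ⟩ := IsAlgClosed.exists_pow_nat_eq (-1 : ℂ) (n := 4) (by norm_num)
  refine ⟨ζ, hζ, ?_, ?_⟩
  · have := congrArg norm hζ
    rw [norm_pow, norm_neg, norm_one] at this
    exact (pow_eq_one_iff_of_nonneg (norm_nonneg _) (by norm_num)).1 this
  · intro h
    have h2 : (2 * ζ * (1 - ζ ^ 2)) ^ 2 = 8 := by
      linear_combination (4 * ζ ^ 2 - 8) * hζ
    rw [h] at h2; norm_num at h2

lemma norm_zq {ζ q : ℂ} (hζ : ‖ζ‖ = 1) (k : ℕ) : ‖ζ ^ k * q‖ = ‖q‖ := by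
  rw [norm_mul, norm_pow, hζ, one_pow, one_mul]

lemma zq_ne {ζ q : ℂ} (hζ : ‖ζ‖ = 1) (hq0 : q ≠ 0) (hq : ‖q‖ < 1) (k : ℕ) (n : ℤ) : ζ ^ k * q * (q ^ 2) ^ n ≠ 1 := by
  intro h
  have h1 := congrArg norm h
  rw [norm_mul, norm_zq hζ, ← zpow_natCast, ← zpow_mul, norm_zpow, ← zpow_one_add₀ (norm_ne_zero_iff.2 hq0), norm_one] at h1
  have := (zpow_eq_one_iff_right₀ (norm_nonneg _) hq.ne).1 h1
  push_cast at this
  omega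

lemma zq_div {ζ q : ℂ} (hζ : ζ ^ 4 = -1) (hq0 : q ≠ 0) {k l : ℕ} (h : k + l = 8) :
    q ^ 2 / (ζ ^ k * q) = ζ ^ l * q := by
  have hz : ζ ≠ 0 := by rintro rfl; norm_num at hζ
  have h8 : ζ ^ k * ζ ^ l = 1 := by rw [← pow_add, h, show ζ ^ 8 = (ζ ^ 4) ^ 2 by ring, hζ]; norm_num
  have := pow_ne_zero k hz
  field_simp
  exact h8.symm

lemma Z1 {q ζ : ℂ} (hq0 : q ≠ 0) (hq : ‖q‖ < 1) (hζ : ζ ^ 4 = -1) (hn : ‖ζ‖ = 1) :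
    FF (ζ ^ 1 * q) (q ^ 2) - FF (ζ ^ 3 * q) (q ^ 2) =
      2 * ζ * (1 - ζ ^ 2) * (phi (q ^ 2) * (2 * phi (q ^ 4) ^ 2 - phi (q ^ 2) ^ 2) * (phi q - phi (q ^ 4)) / 2) := by
  have hz : ζ ≠ 0 := by rintro rfl; norm_num at hζ
  have hQ := norm_sq_lt hq
  have hq4 := norm_pow_lt hq (k := 4) (by norm_num)
  have hq8 := norm_pow_lt hq (k := 8) (by norm_num)
  have hq16 := norm_pow_lt hq (k := 16) (by norm_num)
  have hp := norm_pos_iff.2 hq0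
  have h := FF_diff (pow_ne_zero 2 hq0) hQ (a := ζ ^ 1 * q) (x := ζ ^ 3 * q) (by simp [hz, hq0])
    (by rw [norm_zq hn, norm_pow]; nlinarith) (by rw [norm_zq hn]; exact hq) (zq_ne hn hq0 hq 1)
  rw [zq_div hζ hq0 (l := 5) (by norm_num), show ζ ^ 1 * q * (ζ ^ 3 * q) = -q ^ 2 by linear_combination q ^ 2 * hζ,
    show ζ ^ 1 * q * (ζ ^ 5 * q) = -ζ ^ 2 * q ^ 2 by linear_combination (ζ ^ 2 * q ^ 2) * hζ] at h
  simp only [th] at h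
  rw [zq_div hζ hq0 (k := 1) (l := 7) (by norm_num), zq_div hζ hq0 (k := 3) (l := 5) (by norm_num),
    show q ^ 2 / (-q ^ 2) = -1 by field_simp,
    show q ^ 2 / (-ζ ^ 2 * q ^ 2) = ζ ^ 2 by field_simp; linear_combination -hζ,
    qP_shift (-1) hQ, qP_shift (ζ ^ 2) hQ, show -1 * q ^ 2 = -q ^ 2 by ring, qP_neg_self hQ,
    show ζ ^ 5 * q = -(ζ * q) by linear_combination (ζ * q) * hζ,
    show ζ ^ 7 * q = -(ζ ^ 3 * q) by linear_combination (ζ ^ 3 * q) * hζ, pow_one] at h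
  have m1 := qP_neg_mul (ζ * q) hQ
  have m2 := qP_neg_mul (ζ ^ 3 * q) hQ
  have m3 := qP_neg_mul (ζ ^ 2 * q ^ 2) (q := (q ^ 2) ^ 2) (norm_sq_lt hQ)
  have m4 := qP_neg_mul (ζ ^ 2 * q ^ 2) hQ
  have o1 := qP_neg_odd hq4
  have o2 := qP_neg_self hq4
  rw [show (ζ * q) ^ 2 = ζ ^ 2 * q ^ 2 by ring] at m1
  rw [show (ζ ^ 3 * q) ^ 2 = -(ζ ^ 2 * q ^ 2) by linear_combination (ζ ^ 2 * q ^ 2) * hζ] at m2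
  rw [show (ζ ^ 2 * q ^ 2) ^ 2 = -q ^ 4 by linear_combination (q ^ 4) * hζ] at m3 m4
  rw [show -ζ ^ 2 * q ^ 2 = -(ζ ^ 2 * q ^ 2) by ring] at h
  simp only [← pow_mul] at m1 m2 m3 m4 o1 o2 h
  norm_num at m1 m2 m3 m4 o1 o2 h
  have e1 : qP (ζ * q) (q ^ 2) * qP (-(ζ ^ 3 * q)) (q ^ 2) * (qP (ζ ^ 3 * q) (q ^ 2) * qP (-(ζ * q)) (q ^ 2))
      = ee (q ^ 8) ^ 2 / (ee (q ^ 4) * ee (q ^ 16)) := by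
    rw [← o1, ← m3, ← m1, ← m2]; ring
  have e2 : qP (-(ζ ^ 2 * q ^ 2)) (q ^ 2) * ((1 - ζ ^ 2) * qP (ζ ^ 2 * q ^ 2) (q ^ 2)) =
      (1 - ζ ^ 2) * (ee (q ^ 8) / ee (q ^ 4)) := by
    rw [← o2, ← m4]; ring
  rw [e1, e2] at h
  have p2 := phi_prod (pow_ne_zero 2 hq0) hQ
  have p3 := phi_neg_sq (pow_ne_zero 2 hq0) hQ
  have p4 := phi_neg_prod (pow_ne_zero 2 hq0) hQ
  have p5 := phi_split hq0 hq
  have p6 := psi_prod (pow_ne_zero 4 hq0) hq4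
  rw [p4] at p3
  simp only [← pow_mul] at p2 p3 p6
  norm_num at p2 p3 p6
  rw [← p3, p5, p6, p2]
  have h1 := ee_ne_zero hq
  have h2 := ee_ne_zero hQ
  have h4 := ee_ne_zero hq4
  have h8 := ee_ne_zero hq8
  have h16 := ee_ne_zero hq16
  rw [pow_one]
  generalize FF (ζ * q) (q ^ 2) - FF (ζ ^ 3 * q) (q ^ 2) = D at *
  generalize 1 - ζ ^ 2 = w at *
  field_simp at h ⊢
  linear_combination h

lemma Z2 {q ζ : ℂ} (hq0 : q ≠ 0) (hq : ‖q‖ < 1) (hζ : ζ ^ 4 = -1) (hn : ‖ζ‖ = 1) :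
    6 * (FF (ζ ^ 1 * q) (q ^ 2) + FF (ζ ^ 3 * q) (q ^ 2)) + 1 - 24 * SS (q ^ 2) =
      -11 * phi (q ^ 2) ^ 4 + 16 * phi (q ^ 2) ^ 2 * phi (q ^ 4) ^ 2 - 4 * phi (q ^ 4) ^ 4 := by
  have hQ := norm_sq_lt hq
  have hq4 := norm_pow_lt hq (k := 4) (by norm_num)
  have hz : ∀ k : ℕ, ‖ζ ^ k * q‖ < 1 := fun k => by rw [norm_zq hn]; exact hq
  have hs : FF (ζ ^ 1 * q) (q ^ 2) + FF (ζ ^ 3 * q) (q ^ 2) = 16 * (SS (-q ^ 4) - SS (q ^ 8)) := by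
    have hL := Lam_odd (q := -q ^ 4) (by simpa using hq4)
    rw [show (-q ^ 4) ^ 2 = q ^ 8 by ring] at hL
    rw [← hL, FF_hasSum hQ (hz 1) (by rw [zq_div hζ hq0 (l := 7) (by norm_num)]; exact hz 7),
      FF_hasSum hQ (hz 3) (by rw [zq_div hζ hq0 (l := 5) (by norm_num)]; exact hz 5),
      zq_div hζ hq0 (k := 1) (l := 7) (by norm_num), zq_div hζ hq0 (k := 3) (l := 5) (by norm_num)]
    refine (((Lam_has 1 hQ (hz 1)).add (Lam_has 1 hQ (hz 7))).add
      ((Lam_has 1 hQ (hz 3)).add (Lam_has 1 hQ (hz 5)))).unique ?_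
    have hinj : Function.Injective (fun k : ℕ => 4 * k) := fun a b h => by simpa using h
    have hf : ∀ d : ℕ, (d : ℂ) ^ 1 * (ζ ^ 1 * q) ^ d / (1 - (q ^ 2) ^ d) + (d : ℂ) ^ 1 * (ζ ^ 7 * q) ^ d / (1 - (q ^ 2) ^ d)
      + ((d : ℂ) ^ 1 * (ζ ^ 3 * q) ^ d / (1 - (q ^ 2) ^ d) + (d : ℂ) ^ 1 * (ζ ^ 5 * q) ^ d / (1 - (q ^ 2) ^ d))
      = (d : ℂ) * q ^ d / (1 - (q ^ 2) ^ d) * (ζ ^ d + (ζ ^ 7) ^ d + ((ζ ^ 3) ^ d + (ζ ^ 5) ^ d)) := by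
      intro d; simp only [mul_pow, pow_one]; ring
    simp only [hf]
    refine (hinj.hasSum_iff ?_).1 (hasSum_of_eq ((Lam_has 1 (norm_pow_lt hq (k := 8) (by norm_num)) (x := -q ^ 4) (by simpa using hq4)).mul_left 16) (fun e => ?_) rfl)
    · intro d hd
      rw [ch_sum0 hζ d, mul_zero]
      rintro ⟨e, rfl⟩
      exact hd ⟨e, rfl⟩
    · simp only [Function.comp]
      rw [ch_sum hζ, neg_pow]
      simp only [← pow_mul]
      rw [show 2 * (4 * e) = 8 * e by ring]
      push_cast
      ring
  rw [hs]
  have j1 := phi_four (pow_ne_zero 2 hq0) hQ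
  have j2 := phi_four (q := -q ^ 4) (by simp [hq0]) (by simpa using hq4)
  have j3 := phi_four (pow_ne_zero 4 hq0) hq4
  have j4 := phi_neg_sq_four (pow_ne_zero 2 hq0) hQ
  have j5 := SS_add_neg hq4
  rw [show (-q ^ 4) ^ 4 = q ^ 16 by ring] at j2
  simp only [← pow_mul] at j1 j3 j4 j5
  norm_num at j1 j3 j4 j5
  rw [j4] at j2
  linear_combination 3 * j1 - 8 * j2 + 4 * j3 + 32 * j5

/-- second Lambert series -/
noncomputable def EL (q : ℂ) : ℂ := ∑' d : ℕ, ch d * ((d : ℂ) ^ 3 * q ^ d / (1 - q ^ d))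

lemma ch_norm (d : ℕ) : ‖ch d‖ ≤ 1 := by
  have : ∀ a : ZMod 8, |ZMod.χ₈ a| ≤ 1 := by decide
  rw [ch, Complex.norm_intCast]
  exact_mod_cast this d

lemma EL_summable {q : ℂ} (hq : ‖q‖ < 1) : Summable fun d : ℕ => ch d * ((d : ℂ) ^ 3 * q ^ d / (1 - q ^ d)) := by
  refine Summable.of_norm_bounded (Lam_summable 3 hq hq) fun d => ?_
  rw [norm_mul]
  exact mul_le_of_le_one_left (norm_nonneg _) (ch_norm d)

lemma EL_diff {q : ℂ} (hq0 : q ≠ 0) (hq : ‖q‖ < 1) :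
    EL q - EL (q ^ 2) = phi (q ^ 2) * (2 * phi (q ^ 4) ^ 2 - phi (q ^ 2) ^ 2) * (phi q - phi (q ^ 4)) / 2 *
      (-11 * phi (q ^ 2) ^ 4 + 16 * phi (q ^ 2) ^ 2 * phi (q ^ 4) ^ 2 - 4 * phi (q ^ 4) ^ 4) := by
  obtain ⟨ζ, hζ, hn, hω⟩ := exists_zeta
  have hQ := norm_sq_lt hq
  have hz : ∀ k : ℕ, ‖ζ ^ k * q‖ < 1 := fun k => by rw [norm_zq hn]; exact hq
  have hz0 : ∀ k : ℕ, ζ ^ k * q ≠ 0 := fun k => mul_ne_zero (pow_ne_zero _ (by rintro rfl; norm_num at hζ)) hq0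
  have h3 := FF3_diff (pow_ne_zero 2 hq0) hQ (hz0 1) (hz0 3) (zq_ne hn hq0 hq 1) (zq_ne hn hq0 hq 3)
  rw [Z1 hq0 hq hζ hn, Z2 hq0 hq hζ hn] at h3
  apply mul_left_cancel₀ hω
  rw [← mul_assoc, ← h3, FF3_hasSum hQ (hz 1) (by rw [zq_div hζ hq0 (l := 7) (by norm_num)]; exact hz 7),
      FF3_hasSum hQ (hz 3) (by rw [zq_div hζ hq0 (l := 5) (by norm_num)]; exact hz 5),
      zq_div hζ hq0 (k := 1) (l := 7) (by norm_num), zq_div hζ hq0 (k := 3) (l := 5) (by norm_num)]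
  refine (((EL_summable hq).hasSum.sub (EL_summable hQ).hasSum).mul_left _).unique
    (hasSum_of_eq (((Lam_has 3 hQ (hz 1)).add (Lam_has 3 hQ (hz 7))).sub
      ((Lam_has 3 hQ (hz 3)).add (Lam_has 3 hQ (hz 5)))) (fun d => ?_) rfl)
  rcases Nat.eq_zero_or_pos d with rfl | hd
  · simp
  have hω' := ch_omega hζ d
  have h1 := npow_ne_one hq hd.ne'
  have h2 := npow_ne_one hQ hd.ne'
  have h4 : q ^ d / (1 - q ^ d) - (q ^ 2) ^ d / (1 - (q ^ 2) ^ d) = q ^ d / (1 - (q ^ 2) ^ d) := by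
    simp only [← pow_mul, mul_comm _ d] at *
    simp only [pow_mul] at *
    generalize q ^ d = Q at *
    field_simp
    ring
  simp only [mul_pow, pow_one]
  linear_combination (-(d : ℂ) ^ 3 * (q ^ d / (1 - (q ^ 2) ^ d))) * hω' - (2 * ζ * (1 - ζ ^ 2)) * ch d * (d : ℂ) ^ 3 * h4


/-! ### Algebraic identities -/

lemma alg_T (X Y Z : ℂ) (h : Y^2 = X^2 - 2*X*Z+2*Z^2) :
   X*Y*(X^6/2 - 5*X^4*Y^2+6*X^2*Y^4+4*Y^6) - Y*Z*(Y^6/2 - 5*Y^4*Z^2+6*Y^2*Z^4+4*Z^6)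
    = Y*(2*Z^2-Y^2)*(X-Z)/2 * (-11*Y^4+16*Y^2*Z^2-4*Z^4) := by
  have e : ∀ w, w = X^2 - 2*X*Z+2*Z^2 → Y*(X*(X^6/2 - 5*X^4*w+6*X^2*w^2+4*w^3) - Z*(w^3/2 - 5*w^2*Z^2+6*w*Z^4+4*Z^6)) = Y*((2*Z^2-w)*(X-Z)/2 * (-11*w^2+16*w*Z^2-4*Z^4)) := by
    rintro w rfl; ring
  linear_combination e _ h

lemma alg_final (X Y Z : ℂ) (h : Y^2 = X^2 - 2*X*Z+2*Z^2) :
   X^2*Y*Z^5 = 4/11 * (X*Y*(X^2-Y^2)/4 * (3/4*(X^4-Y^4)+(Y^4+X^2*(2*Y^2-X^2))/2))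
    + 2/11*(Y*Z*(Y^6/2 - 5*Y^4*Z^2+6*Y^2*Z^4+4*Z^6))
    + 12/11 * (X^3*Y*(2*Y^2-X^2)*(X^2-Y^2)/4) + 28/11 * (X*Y^3*(2*Y^2-X^2)*(X^2-Y^2)/4)
    + 92/11 * (Y^3*Z*(2*Z^2-Y^2)*(Y^2-Z^2)/4) - 28/11 * (Y*Z^3*(2*Z^2-Y^2)*(Y^2-Z^2)/4) := by
  have e : ∀ w, w = X^2 - 2*X*Z+2*Z^2 → Y*(X^2*Z^5) = Y*(4/11 * (X*(X^2-w)/4 * (3/4*(X^4-w^2)+(w^2+X^2*(2*w-X^2))/2))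
    + 2/11*(Z*(w^3/2 - 5*w^2*Z^2+6*w*Z^4+4*Z^6))
    + 12/11 * (X^3*(2*w-X^2)*(X^2-w)/4) + 28/11 * (X*w*(2*w-X^2)*(X^2-w)/4)
    + 92/11 * (w*Z*(2*Z^2-w)*(w-Z^2)/4) - 28/11 * (Z^3*(2*Z^2-w)*(w-Z^2)/4)) := by
    rintro w rfl; ring
  linear_combination e _ h


/-! ### Second Eisenstein series -/

lemma phi_limit {q : ℂ} (hq0 : q ≠ 0) (hq : ‖q‖ < 1) {r : ℕ → ℂ} (hr : ∀ k, ‖r k‖ ≤ ‖q‖)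
    (hr0 : Filter.Tendsto r Filter.atTop (nhds 0)) :
    Filter.Tendsto (fun k => phi (r k)) Filter.atTop (nhds 1) := by
  have h1 : ∑' n : ℤ, (if n = 0 then (1 : ℂ) else 0) = 1 := (hasSum_ite_eq (0 : ℤ) (1 : ℂ)).tsum_eq
  rw [← h1]
  unfold phi
  refine tendsto_tsum_of_dominated_convergence (bound := fun n : ℤ => ‖q ^ (n ^ 2)‖) (phi_summable hq0 hq) ?_ ?_
  · intro n
    rcases eq_or_ne n 0 with rfl | hn
    · simp
    · simp only [hn, if_false]
      obtain ⟨m, hm⟩ := Int.eq_ofNat_of_zero_le (sq_nonneg n)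
      have hm0 : m ≠ 0 := by
        rintro rfl
        simp at hm; exact hn hm
      simp only [hm, zpow_natCast]
      have := hr0.pow m
      rwa [zero_pow hm0] at this
  · refine Filter.Eventually.of_forall fun k n => ?_
    obtain ⟨m, hm⟩ := Int.eq_ofNat_of_zero_le (sq_nonneg n)
    simp only [hm, zpow_natCast, norm_pow]
    gcongr; exact hr k

lemma EL_limit {q : ℂ} (hq : ‖q‖ < 1) {r : ℕ → ℂ} (hr : ∀ k, ‖r k‖ ≤ ‖q‖)
    (hr0 : Filter.Tendsto r Filter.atTop (nhds 0)) :
    Filter.Tendsto (fun k => EL (r k)) Filter.atTop (nhds 0) := by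
  rw [show (0 : ℂ) = ∑' d : ℕ, (0 : ℂ) by simp]
  unfold EL
  have hq' : ‖((‖q‖ : ℝ) : ℂ)‖ < 1 := by simpa using hq
  refine tendsto_tsum_of_dominated_convergence
    (bound := fun d : ℕ => ‖(d : ℂ) ^ 3 * ((‖q‖ : ℝ) : ℂ) ^ d / (1 - ((‖q‖ : ℝ) : ℂ) ^ d)‖) (Lam_summable 3 hq' hq') ?_ ?_
  · intro d
    rcases Nat.eq_zero_or_pos d with rfl | hd
    · simp
    · have h := hr0.pow d
      rw [zero_pow hd.ne'] at h
      have h2 := ((h.const_mul ((d : ℂ) ^ 3)).div (tendsto_const_nhds (x := (1 : ℂ)).sub h) (by simp)).const_mul (ch d)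
      simpa using h2
  · refine Filter.Eventually.of_forall fun k d => ?_
    rcases Nat.eq_zero_or_pos d with rfl | hd
    · simp
    rw [norm_mul]
    refine (mul_le_of_le_one_left (norm_nonneg _) (ch_norm d)).trans ?_
    have h1 : 0 < 1 - ‖q‖ ^ d := by
      have := pow_lt_one₀ (norm_nonneg q) hq hd.ne'
      linarith
    have h2 : ‖(1 - ((‖q‖ : ℝ) : ℂ) ^ d)‖ = 1 - ‖q‖ ^ d := by
      rw [← Complex.ofReal_pow, ← Complex.ofReal_one, ← Complex.ofReal_sub, Complex.norm_real, Real.norm_eq_abs, abs_of_pos h1]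
    rw [norm_div, norm_div, h2, norm_mul, norm_mul, norm_pow (r k), norm_pow ((‖q‖ : ℝ) : ℂ), Complex.norm_real, norm_norm]
    have h3 : ‖r k‖ ^ d ≤ ‖q‖ ^ d := pow_le_pow_left₀ (norm_nonneg _) (hr k) d
    have h4 : 1 - ‖q‖ ^ d ≤ ‖1 - r k ^ d‖ := by
      have := norm_sub_norm_le 1 (r k ^ d)
      rw [norm_one, norm_pow] at this
      linarith
    gcongr

/-- polynomial appearing in the second Eisenstein series -/
noncomputable def PP (X Y : ℂ) : ℂ := X * Y * (X ^ 6 / 2 - 5 * X ^ 4 * Y ^ 2 + 6 * X ^ 2 * Y ^ 4 + 4 * Y ^ 6)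

lemma PP_tendsto {u v : ℕ → ℂ} {a b : ℂ} (hu : Filter.Tendsto u Filter.atTop (nhds a))
    (hv : Filter.Tendsto v Filter.atTop (nhds b)) :
    Filter.Tendsto (fun k => PP (u k) (v k)) Filter.atTop (nhds (PP a b)) := by
  unfold PP
  exact (hu.mul hv).mul (((((hu.pow 6).div_const 2).sub (((hu.pow 4).const_mul 5).mul (hv.pow 2))).add
    (((hu.pow 2).const_mul 6).mul (hv.pow 4))).add ((hv.pow 6).const_mul 4))

lemma EL_step {q : ℂ} (hq0 : q ≠ 0) (hq : ‖q‖ < 1) :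
    EL (q ^ 2) - PP (phi (q ^ 2)) (phi ((q ^ 2) ^ 2)) = EL q - PP (phi q) (phi (q ^ 2)) := by
  have h1 := EL_diff hq0 hq
  have h2 := alg_T _ _ _ (phi_rel hq0 hq)
  rw [show (q ^ 2) ^ 2 = q ^ 4 by ring]
  unfold PP
  linear_combination h2 - h1

lemma EL_limit_eq {q : ℂ} (hq0 : q ≠ 0) (hq : ‖q‖ < 1) (r : ℕ → ℂ) (h0 : r 0 = q)
    (hs : ∀ k, r (k + 1) = r k ^ 2) (hr : ∀ k, ‖r k‖ ≤ ‖q‖) (hn : ∀ k, r k ≠ 0)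
    (hr0 : Filter.Tendsto r Filter.atTop (nhds 0)) :
    11 / 2 + EL q = PP (phi q) (phi (q ^ 2)) := by
  have hstep : ∀ k, EL (r k) - PP (phi (r k)) (phi (r k ^ 2)) = EL q - PP (phi q) (phi (q ^ 2)) := by
    intro k
    induction k with
    | zero => rw [h0]
    | succ k ih =>
      rw [← ih, hs]
      exact EL_step (hn k) ((hr k).trans_lt hq)
  have l1 := phi_limit hq0 hq hr hr0
  have l2 := phi_limit (r := fun k => r k ^ 2) hq0 hq (fun k => by
    rw [norm_pow]
    exact (pow_le_of_le_one (norm_nonneg _) ((hr k).trans hq.le) two_ne_zero).trans (hr k))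
    (by simpa using hr0.pow 2)
  have l3 := EL_limit hq hr hr0
  have hP := l3.sub (PP_tendsto l1 l2)
  simp only [hstep] at hP
  have h := tendsto_nhds_unique hP tendsto_const_nhds
  have : PP 1 1 = 11 / 2 := by unfold PP; norm_num
  rw [this] at h
  linear_combination -h

theorem EL_formula {q : ℂ} (hq0 : q ≠ 0) (hq : ‖q‖ < 1) :
    11 / 2 + EL q = PP (phi q) (phi (q ^ 2)) := by
  refine EL_limit_eq hq0 hq (fun k => q ^ (2 ^ k)) (by simp) (fun k => ?_) (fun k => ?_)
    (fun k => pow_ne_zero _ hq0) ?_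
  · rw [← pow_mul, pow_succ]
  · simp only [norm_pow]
    exact pow_le_of_le_one (norm_nonneg _) hq.le (by positivity)
  · exact (tendsto_pow_atTop_nhds_zero_of_norm_lt_one hq).comp (tendsto_pow_atTop_atTop_of_one_lt (by norm_num))

/-! ### The eta quotients -/

lemma A1_formula {q : ℂ} (hq0 : q ≠ 0) (hq : ‖q‖ < 1) :
    q * (ee q ^ (-2 : ℤ) * ee (q ^ 2) ^ (11 : ℤ) * ee (q ^ 4) ^ (-3 : ℤ) * ee (q ^ 8) ^ (2 : ℤ)) =
      phi q ^ 3 * phi (q ^ 2) * (2 * phi (q ^ 2) ^ 2 - phi q ^ 2) * (phi q ^ 2 - phi (q ^ 2) ^ 2) / 4 := by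
  have hq2 := norm_sq_lt hq
  have p2 := phi_prod (pow_ne_zero 2 hq0) hq2
  simp only [← pow_mul] at p2
  norm_num at p2
  rw [← phi_neg_sq hq0 hq, phi_neg_prod hq0 hq, phi_sq_sub hq0 hq, p2, phi_prod hq0 hq]
  have h1 := ee_ne_zero hq
  have h2 := ee_ne_zero hq2
  have h4 := ee_ne_zero (norm_pow_lt hq (k := 4) (by norm_num))
  have h8 := ee_ne_zero (norm_pow_lt hq (k := 8) (by norm_num))
  simp only [zpow_neg]
  norm_cast
  field_simp

lemma A2_formula {q : ℂ} (hq0 : q ≠ 0) (hq : ‖q‖ < 1) :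
    q * (ee q ^ (2 : ℤ) * ee (q ^ 2) ^ (-3 : ℤ) * ee (q ^ 4) ^ (11 : ℤ) * ee (q ^ 8) ^ (-2 : ℤ)) =
      phi q * phi (q ^ 2) ^ 3 * (2 * phi (q ^ 2) ^ 2 - phi q ^ 2) * (phi q ^ 2 - phi (q ^ 2) ^ 2) / 4 := by
  have hq2 := norm_sq_lt hq
  have p2 := phi_prod (pow_ne_zero 2 hq0) hq2
  simp only [← pow_mul] at p2
  norm_num at p2
  rw [← phi_neg_sq hq0 hq, phi_neg_prod hq0 hq, phi_sq_sub hq0 hq, p2, phi_prod hq0 hq]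
  have h1 := ee_ne_zero hq
  have h2 := ee_ne_zero hq2
  have h4 := ee_ne_zero (norm_pow_lt hq (k := 4) (by norm_num))
  have h8 := ee_ne_zero (norm_pow_lt hq (k := 8) (by norm_num))
  simp only [zpow_neg]
  norm_cast
  field_simp


/-! ### Lambert series -/

lemma pnat_hasSum {f : ℕ → ℂ} (h0 : f 0 = 0) {s : ℂ} :
    HasSum (fun n : ℕ+ => f n) s ↔ HasSum f s := by
  refine PNat.coe_injective.hasSum_iff (f := f) ?_
  intro x hx
  rcases Nat.eq_zero_or_pos x with rfl | h
  · exact h0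
  · exact absurd ⟨⟨x, h⟩, rfl⟩ hx

lemma lambert_general {q : ℂ} (hq : ‖q‖ < 1) (c : ℕ → ℕ → ℂ) (hc : ∀ d m, ‖c d m‖ ≤ (d : ℝ) ^ 3)
    (L : ℕ → ℂ) (hL : ∀ d : ℕ+, HasSum (fun m : ℕ+ => c d m * q ^ ((d : ℕ) * m)) (L d)) {s : ℂ}
    (hs : HasSum (fun d : ℕ+ => L d) s) :
    HasSum (fun n : ℕ => (∑ d ∈ n.divisors, c d (n / d)) * q ^ n) s := by
  let F : ℕ+ × ℕ+ → ℂ := fun p => c p.1 p.2 * q ^ ((p.1 : ℕ) * p.2)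
  have hF : Summable F := by
    have h := (summable_prod_mul_pow (𝕜 := ℝ) 3 (r := ‖q‖) (by simpa using hq)).prod_symm
    refine Summable.of_norm_bounded h fun p => ?_
    simp only [F, norm_mul, norm_pow, Prod.fst_swap, Prod.snd_swap]
    rw [mul_comm (p.2 : ℕ)]
    gcongr
    exact hc _ _
  have h1 : HasSum F s := by
    have h2 := hF.hasSum.prod_fiberwise (g := fun d : ℕ+ => L d) hL
    rw [hs.unique h2]
    exact hF.hasSum
  rw [← pnat_hasSum (by simp)]
  rw [← sigmaAntidiagonalEquivProd.hasSum_iff] at h1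
  refine h1.sigma fun n => ?_
  convert hasSum_fintype _ using 1
  rw [← Nat.sum_divisorsAntidiagonal (fun x y => c x y), Finset.sum_mul, Finset.univ_eq_attach,
    ← Finset.sum_attach]
  refine Finset.sum_congr rfl fun x _ => ?_
  have := (Nat.mem_divisorsAntidiagonal.mp x.2).1
  simp only [Function.comp, F, sigmaAntidiagonalEquivProd, divisorsAntidiagonalFactors, Equiv.coe_fn_mk, PNat.mk_coe]
  rw [this]

lemma geo_pnat {x : ℂ} (hx : ‖x‖ < 1) : HasSum (fun m : ℕ+ => x ^ (m : ℕ)) (x / (1 - x)) := by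
  have h := (hasSum_geometric_of_norm_lt_one hx).mul_left x
  rw [← Equiv.pnatEquivNat.symm.hasSum_iff]
  refine hasSum_of_eq h (fun n => ?_) (by ring)
  simp [pow_succ, mul_comm]

lemma ch_pnat {x : ℂ} (hx : ‖x‖ < 1) : HasSum (fun m : ℕ+ => ch m * x ^ (m : ℕ))
    ((x + x ^ 7 - (x ^ 3 + x ^ 5)) / (1 - x ^ 8)) := by
  rw [pnat_hasSum (f := fun m => ch m * x ^ m) (by simp [ch])]
  have hs : Summable fun m : ℕ => ch m * x ^ m := by
    refine Summable.of_norm_bounded (summable_geometric_of_lt_one (norm_nonneg x) hx) fun m => ?_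
    rw [norm_mul, norm_pow]
    exact mul_le_of_le_one_left (by positivity) (ch_norm m)
  have h := hs.sum_add_tsum_nat_add 8
  have h2 : ∀ m : ℕ, ch (m + 8) * x ^ (m + 8) = x ^ 8 * (ch m * x ^ m) := by
    intro m
    have : ch (m + 8) = ch m := by
      unfold ch
      push_cast
      rw [show (8 : ZMod 8) = 0 from rfl, add_zero]
    rw [this]; ring
  simp only [h2, tsum_mul_left] at h
  have c0 : ch 0 = 0 := by simp [ch]
  have c1 : ch 1 = 1 := by simp [ch]
  have c2 : ch 2 = 0 := by
    have : ZMod.χ₈ ((2 : ℕ) : ZMod 8) = 0 := by decide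
    rw [ch, this]; simp
  have c3 : ch 3 = -1 := by
    have : ZMod.χ₈ ((3 : ℕ) : ZMod 8) = -1 := by decide
    rw [ch, this]; simp
  have c4 : ch 4 = 0 := by
    have : ZMod.χ₈ ((4 : ℕ) : ZMod 8) = 0 := by decide
    rw [ch, this]; simp
  have c5 : ch 5 = -1 := by
    have : ZMod.χ₈ ((5 : ℕ) : ZMod 8) = -1 := by decide
    rw [ch, this]; simp
  have c6 : ch 6 = 0 := by
    have : ZMod.χ₈ ((6 : ℕ) : ZMod 8) = 0 := by decide
    rw [ch, this]; simp
  have c7 : ch 7 = 1 := by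
    have : ZMod.χ₈ ((7 : ℕ) : ZMod 8) = 1 := by decide
    rw [ch, this]; simp
  simp only [Finset.sum_range_succ, Finset.sum_range_zero, c0, c1, c2, c3, c4, c5, c6, c7] at h
  have hne := npow_ne_one hx (d := 8) (by norm_num)
  have : ∑' m : ℕ, ch m * x ^ m = (x + x ^ 7 - (x ^ 3 + x ^ 5)) / (1 - x ^ 8) := by
    rw [eq_div_iff hne]
    linear_combination -h
  rw [← this]
  exact hs.hasSum

lemma sigmaOne_gen {q : ℂ} (hq : ‖q‖ < 1) : HasSum (fun n : ℕ => (sigmaOneChi8 n : ℂ) * q ^ n) (EL q) := by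
  have h := lambert_general hq (fun d _ => ch d * (d : ℂ) ^ 3) (fun d m => by
    rw [norm_mul, norm_pow, Complex.norm_natCast]
    exact mul_le_of_le_one_left (by positivity) (ch_norm d))
    (fun d => ch d * ((d : ℂ) ^ 3 * q ^ d / (1 - q ^ d))) (fun d => by
      have hd := geo_pnat (norm_pow_lt hq (k := (d : ℕ)) d.ne_zero)
      refine hasSum_of_eq (hd.mul_left (ch d * (d : ℂ) ^ 3)) (fun m => ?_) (by ring)
      rw [pow_mul]) (s := EL q) (by
      rw [pnat_hasSum (f := fun d => ch d * ((d : ℂ) ^ 3 * q ^ d / (1 - q ^ d))) (by simp)]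
      exact (EL_summable hq).hasSum)
  refine hasSum_of_eq h (fun n => ?_) rfl
  simp [sigmaOneChi8, ch]

lemma sigmaChi_gen {q : ℂ} (hq : ‖q‖ < 1) : HasSum (fun n : ℕ => (sigmaChi8One n : ℂ) * q ^ n)
    (Lam 3 q (q^8) + Lam 3 (q^7) (q^8) - (Lam 3 (q^3) (q^8) + Lam 3 (q^5) (q^8))) := by
  have h8 := norm_pow_lt hq (k := 8) (by norm_num)
  have h := lambert_general hq (fun d m => ch m * (d : ℂ) ^ 3) (fun d m => by
    rw [norm_mul, norm_pow, Complex.norm_natCast]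
    exact mul_le_of_le_one_left (by positivity) (ch_norm m))
    (fun d => (d : ℂ) ^ 3 * q ^ d / (1 - (q ^ 8) ^ d) + (d : ℂ) ^ 3 * (q ^ 7) ^ d / (1 - (q ^ 8) ^ d) -
      ((d : ℂ) ^ 3 * (q ^ 3) ^ d / (1 - (q ^ 8) ^ d) + (d : ℂ) ^ 3 * (q ^ 5) ^ d / (1 - (q ^ 8) ^ d))) (fun d => by
      have hd := ch_pnat (norm_pow_lt hq (k := (d : ℕ)) d.ne_zero)
      refine hasSum_of_eq (hd.mul_left ((d : ℂ) ^ 3)) (fun m => ?_) ?_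
      · rw [pow_mul]; ring
      · simp only [← pow_mul, mul_comm (d : ℕ)]
        ring)
    ((pnat_hasSum (f := fun d => (d : ℂ) ^ 3 * q ^ d / (1 - (q ^ 8) ^ d) + (d : ℂ) ^ 3 * (q ^ 7) ^ d / (1 - (q ^ 8) ^ d) -
      ((d : ℂ) ^ 3 * (q ^ 3) ^ d / (1 - (q ^ 8) ^ d) + (d : ℂ) ^ 3 * (q ^ 5) ^ d / (1 - (q ^ 8) ^ d))) (by simp)).2
      (((Lam_has 3 h8 hq).add (Lam_has 3 h8 (norm_pow_lt hq (k := 7) (by norm_num)))).sub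
      ((Lam_has 3 h8 (norm_pow_lt hq (k := 3) (by norm_num))).add (Lam_has 3 h8 (norm_pow_lt hq (k := 5) (by norm_num))))))
  refine hasSum_of_eq h (fun n => ?_) rfl
  simp [sigmaChi8One, ch]


/-! ### Theta generating function -/

lemma hasSum_pi_prod : ∀ (n : ℕ) (f : Fin n → ℤ → ℂ) (_ : ∀ i, Summable fun k => ‖f i k‖),
    (Summable fun x : Fin n → ℤ => ‖∏ i, f i (x i)‖) ∧
    HasSum (fun x : Fin n → ℤ => ∏ i, f i (x i)) (∏ i, ∑' k, f i k) := by
  intro n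
  induction n with
  | zero =>
    intro f _
    refine ⟨(hasSum_fintype _).summable, ?_⟩
    simp
  | succ n ih =>
    intro f hf
    obtain ⟨h1, h2⟩ := ih (fun i => f i.succ) (fun i => hf _)
    have e : ∀ p : ℤ × (Fin n → ℤ), ∏ i, f i (Fin.consEquiv (fun _ => ℤ) p i) = f 0 p.1 * ∏ i : Fin n, f i.succ (p.2 i) := by
      intro p
      rw [Fin.prod_univ_succ]
      simp [Fin.consEquiv]
    constructor
    · rw [← (Fin.consEquiv (fun _ => ℤ)).summable_iff]
      refine ((hf 0).mul_norm h1).congr fun p => ?_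
      simp only [Function.comp, e]
    · rw [← (Fin.consEquiv (fun _ => ℤ)).hasSum_iff, Fin.prod_univ_succ]
      have h4 : Summable fun p : ℤ × (Fin n → ℤ) => f 0 p.1 * ∏ i : Fin n, f i.succ (p.2 i) :=
        summable_mul_of_summable_norm (f := f 0) (g := fun x : Fin n → ℤ => ∏ i : Fin n, f i.succ (x i)) (hf 0) h1
      have h5 : HasSum (f 0) (∑' k, f 0 k) := (hf 0).of_norm.hasSum
      have h3 := h5.mul h2 h4
      refine hasSum_of_eq h3 (fun p => ?_) rfl
      simp only [Function.comp, e]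

lemma theta_gen {q : ℂ} (hq0 : q ≠ 0) (hq : ‖q‖ < 1) (a : Fin 8 → ℕ) (ha : ∀ i, a i ≠ 0) :
    HasSum (fun n : ℕ => (repCount a n : ℂ) * q ^ n) (∏ i, phi (q ^ a i)) := by
  obtain ⟨h1, h2⟩ := hasSum_pi_prod 8 (fun i k => (q ^ a i) ^ (k ^ 2))
    (fun i => phi_summable (pow_ne_zero _ hq0) (norm_pow_lt hq (ha i)))
  let N : (Fin 8 → ℤ) → ℕ := fun x => (∑ i, (a i : ℤ) * x i ^ 2).toNat
  have hN : ∀ x, ((N x : ℕ) : ℤ) = ∑ i, (a i : ℤ) * x i ^ 2 := fun x =>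
    Int.toNat_of_nonneg (Finset.sum_nonneg fun i _ => by positivity)
  have hF : ∀ x : Fin 8 → ℤ, ∏ i, (q ^ a i) ^ (x i ^ 2) = q ^ N x := by
    intro x
    rw [← zpow_natCast q (N x), hN]
    rw [← Finset.prod_congr rfl (fun i _ => by rw [zpow_mul, zpow_natCast] : ∀ i ∈ Finset.univ, q ^ ((a i : ℤ) * x i ^ 2) = (q ^ a i) ^ (x i ^ 2))]
    simp only [Fin.prod_univ_succ, Fin.sum_univ_succ, zpow_add₀ hq0]
    simp
  simp only [hF] at h2
  rw [← (Equiv.sigmaFiberEquiv N).hasSum_iff] at h2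
  refine hasSum_of_eq (h2.sigma fun n => (h2.summable.sigma_factor n).hasSum) (fun n => ?_) rfl
  have : ∀ c : {x // N x = n}, (((fun x => q ^ N x) ∘ (Equiv.sigmaFiberEquiv N)) ⟨n, c⟩) = q ^ n := by
    rintro ⟨c, rfl⟩
    rfl
  simp only [this, tsum_const, nsmul_eq_mul]
  congr 2
  refine Nat.card_congr (Equiv.subtypeEquivRight fun x => ?_)
  rw [← hN]
  exact Nat.cast_inj.symm

/-! ### Eta functions -/

lemma eta_ee (w : ℂ) : dedekindEta w = Complex.exp (Real.pi * Complex.I * w / 12) *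
    ee (Complex.exp (2 * Real.pi * Complex.I * w)) := by
  unfold dedekindEta ee qP
  congr 2
  funext m
  rw [← pow_succ', ← Complex.exp_nat_mul]
  congr 2
  push_cast
  ring

lemma eta_k (k : ℕ) (z : ℂ) : dedekindEta (k * z) = Complex.exp (Real.pi * Complex.I * z / 12) ^ k *
    ee (Complex.exp (2 * Real.pi * Complex.I * z) ^ k) := by
  rw [eta_ee, ← Complex.exp_nat_mul, ← Complex.exp_nat_mul]
  congr 3 <;> ring

lemma eta_quot1 {z q : ℂ} (hz : Complex.exp (2 * Real.pi * Complex.I * z) = q) :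
    dedekindEta z ^ (-2 : ℤ) * dedekindEta (2 * z) ^ (11 : ℤ) * dedekindEta (4 * z) ^ (-3 : ℤ) * dedekindEta (8 * z) ^ (2 : ℤ)
      = q * (ee q ^ (-2 : ℤ) * ee (q ^ 2) ^ (11 : ℤ) * ee (q ^ 4) ^ (-3 : ℤ) * ee (q ^ 8) ^ (2 : ℤ)) := by
  have h1 := eta_k 1 z
  have h2 := eta_k 2 z
  have h4 := eta_k 4 z
  have h8 := eta_k 8 z
  have hu : Complex.exp (Real.pi * Complex.I * z / 12) ^ 24 = q := by
    rw [← hz, ← Complex.exp_nat_mul]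
    congr 1; push_cast; ring
  have hu0 := Complex.exp_ne_zero (Real.pi * Complex.I * z / 12)
  push_cast at h1 h2 h4 h8
  rw [one_mul, pow_one, pow_one] at h1
  rw [hz] at h1 h2 h4 h8
  rw [h1, h2, h4, h8]
  generalize Complex.exp (Real.pi * Complex.I * z / 12) = u at *
  simp only [mul_zpow, ← zpow_natCast, ← zpow_mul]
  have : u ^ (-2 : ℤ) * u ^ (22 : ℤ) * u ^ (-12 : ℤ) * u ^ (16 : ℤ) = q := by
    rw [← hu, ← zpow_add₀ hu0, ← zpow_add₀ hu0, ← zpow_add₀ hu0]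
    norm_cast
  rw [← this]
  norm_num
  ring

lemma eta_quot2 {z q : ℂ} (hz : Complex.exp (2 * Real.pi * Complex.I * z) = q) :
    dedekindEta z ^ (2 : ℤ) * dedekindEta (2 * z) ^ (-3 : ℤ) * dedekindEta (4 * z) ^ (11 : ℤ) * dedekindEta (8 * z) ^ (-2 : ℤ)
      = q * (ee q ^ (2 : ℤ) * ee (q ^ 2) ^ (-3 : ℤ) * ee (q ^ 4) ^ (11 : ℤ) * ee (q ^ 8) ^ (-2 : ℤ)) := by
  have h1 := eta_k 1 z
  have h2 := eta_k 2 z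
  have h4 := eta_k 4 z
  have h8 := eta_k 8 z
  have hu : Complex.exp (Real.pi * Complex.I * z / 12) ^ 24 = q := by
    rw [← hz, ← Complex.exp_nat_mul]
    congr 1; push_cast; ring
  have hu0 := Complex.exp_ne_zero (Real.pi * Complex.I * z / 12)
  push_cast at h1 h2 h4 h8
  rw [one_mul, pow_one, pow_one] at h1
  rw [hz] at h1 h2 h4 h8
  rw [h1, h2, h4, h8]
  generalize Complex.exp (Real.pi * Complex.I * z / 12) = u at *
  simp only [mul_zpow, ← zpow_natCast, ← zpow_mul]
  have : u ^ (2 : ℤ) * u ^ (-6 : ℤ) * u ^ (44 : ℤ) * u ^ (-16 : ℤ) = q := by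
    rw [← hu, ← zpow_add₀ hu0, ← zpow_add₀ hu0, ← zpow_add₀ hu0]
    norm_cast
  rw [← this]
  norm_num
  ring

lemma exists_z {q : ℂ} (hq0 : q ≠ 0) (hq : ‖q‖ < 1) :
    ∃ z : ℂ, 0 < z.im ∧ Complex.exp (2 * Real.pi * Complex.I * z) = q := by
  refine ⟨Function.Periodic.invQParam 1 q, Function.Periodic.im_invQParam_pos_of_norm_lt_one one_pos hq hq0, ?_⟩
  have := Function.Periodic.qParam_right_inv (h := 1) one_ne_zero hq0
  simpa [Function.Periodic.qParam] using this

/-- coefficient sequence with the zeroth term removed -/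
noncomputable def cut (a : ℕ → ℤ) (n : ℕ) : ℂ := if n = 0 then 0 else (a n : ℂ)

lemma cut_hasSum {a : ℕ → ℤ} {q s : ℂ} (hs : s ≠ 0) (h : s = ∑' m : ℕ, (a (m + 1) : ℂ) * q ^ (m + 1)) :
    HasSum (fun n : ℕ => cut a n * q ^ n) s := by
  have hS : Summable fun m : ℕ => (a (m + 1) : ℂ) * q ^ (m + 1) := by
    by_contra hc
    rw [tsum_eq_zero_of_not_summable hc] at h
    exact hs h
  rw [← hasSum_nat_add_iff' 1]
  refine hasSum_of_eq hS.hasSum (fun n => ?_) ?_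
  · simp [cut]
  · simp [cut, h]

lemma a1_gen {a1 : ℕ → ℤ} (ha1 : ∀ z : ℂ, 0 < z.im →
      dedekindEta z ^ (-2 : ℤ) * dedekindEta (2 * z) ^ (11 : ℤ) * dedekindEta (4 * z) ^ (-3 : ℤ) * dedekindEta (8 * z) ^ (2 : ℤ)
        = ∑' m : ℕ, (a1 (m + 1) : ℂ) * Complex.exp (2 * Real.pi * Complex.I * z) ^ (m + 1))
    {q : ℂ} (hq0 : q ≠ 0) (hq : ‖q‖ < 1) :
    HasSum (fun n : ℕ => cut a1 n * q ^ n)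
      (phi q ^ 3 * phi (q ^ 2) * (2 * phi (q ^ 2) ^ 2 - phi q ^ 2) * (phi q ^ 2 - phi (q ^ 2) ^ 2) / 4) := by
  obtain ⟨z, hz, hzq⟩ := exists_z hq0 hq
  have h := ha1 z hz
  rw [eta_quot1 hzq, hzq] at h
  rw [← A1_formula hq0 hq]
  refine cut_hasSum ?_ h
  have h1 := ee_ne_zero hq
  have h2 := ee_ne_zero (norm_pow_lt hq (k := 2) (by norm_num))
  have h4 := ee_ne_zero (norm_pow_lt hq (k := 4) (by norm_num))
  have h8 := ee_ne_zero (norm_pow_lt hq (k := 8) (by norm_num))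
  exact mul_ne_zero hq0 (mul_ne_zero (mul_ne_zero (mul_ne_zero (zpow_ne_zero _ h1) (zpow_ne_zero _ h2)) (zpow_ne_zero _ h4)) (zpow_ne_zero _ h8))

lemma a2_gen {a2 : ℕ → ℤ} (ha2 : ∀ z : ℂ, 0 < z.im →
      dedekindEta z ^ (2 : ℤ) * dedekindEta (2 * z) ^ (-3 : ℤ) * dedekindEta (4 * z) ^ (11 : ℤ) * dedekindEta (8 * z) ^ (-2 : ℤ)
        = ∑' m : ℕ, (a2 (m + 1) : ℂ) * Complex.exp (2 * Real.pi * Complex.I * z) ^ (m + 1))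
    {q : ℂ} (hq0 : q ≠ 0) (hq : ‖q‖ < 1) :
    HasSum (fun n : ℕ => cut a2 n * q ^ n)
      (phi q * phi (q ^ 2) ^ 3 * (2 * phi (q ^ 2) ^ 2 - phi q ^ 2) * (phi q ^ 2 - phi (q ^ 2) ^ 2) / 4) := by
  obtain ⟨z, hz, hzq⟩ := exists_z hq0 hq
  have h := ha2 z hz
  rw [eta_quot2 hzq, hzq] at h
  rw [← A2_formula hq0 hq]
  refine cut_hasSum ?_ h
  have h1 := ee_ne_zero hq
  have h2 := ee_ne_zero (norm_pow_lt hq (k := 2) (by norm_num))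
  have h4 := ee_ne_zero (norm_pow_lt hq (k := 4) (by norm_num))
  have h8 := ee_ne_zero (norm_pow_lt hq (k := 8) (by norm_num))
  exact mul_ne_zero hq0 (mul_ne_zero (mul_ne_zero (mul_ne_zero (zpow_ne_zero _ h1) (zpow_ne_zero _ h2)) (zpow_ne_zero _ h4)) (zpow_ne_zero _ h8))


/-! ### Uniqueness of coefficients and conclusion -/

lemma coeff_zero {c : ℕ → ℂ} (h : ∀ q : ℂ, q ≠ 0 → ‖q‖ < 1 → HasSum (fun n => c n * q ^ n) 0) (n : ℕ) :
    c n = 0 := by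
  induction n using Nat.strong_induction_on with
  | _ n ih =>
    have h1 : ∀ q : ℂ, q ≠ 0 → ‖q‖ < 1 → HasSum (fun m => c (m + n) * q ^ m) 0 := by
      intro q hq0 hq
      have h2 := h q hq0 hq
      rw [← hasSum_nat_add_iff' n] at h2
      have h3 := h2.mul_left ((q ^ n)⁻¹)
      have h4 : ∑ i ∈ range n, c i * q ^ i = 0 :=
        Finset.sum_eq_zero fun i hi => by rw [ih i (Finset.mem_range.mp hi), zero_mul]
      refine hasSum_of_eq h3 (fun m => ?_) (by rw [h4]; simp)
      have := pow_ne_zero n hq0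
      rw [pow_add]
      field_simp
    have hr : Filter.Tendsto (fun k : ℕ => ((1 / 2 : ℂ)) ^ (k + 1)) Filter.atTop (nhds 0) :=
      (Filter.tendsto_add_atTop_iff_nat 1).2 (tendsto_pow_atTop_nhds_zero_of_norm_lt_one (by norm_num))
    have hlim : Filter.Tendsto (fun k : ℕ => ∑' m : ℕ, c (m + n) * (((1 / 2 : ℂ)) ^ (k + 1)) ^ m) Filter.atTop
        (nhds (∑' m : ℕ, if m = 0 then c n else 0)) := by
      refine tendsto_tsum_of_dominated_convergence (bound := fun m => ‖c (m + n) * (1 / 2 : ℂ) ^ m‖)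
        (h1 (1 / 2) (by norm_num) (by norm_num)).summable.norm ?_ ?_
      · intro m
        rcases eq_or_ne m 0 with rfl | hm
        · simp
        · have := (hr.pow m).const_mul (c (m + n))
          rw [zero_pow hm, mul_zero] at this
          simpa only [hm, if_false] using this
      · refine Filter.Eventually.of_forall fun k m => ?_
        rw [norm_mul, norm_mul]
        gcongr
        rw [norm_pow, norm_pow, norm_pow]
        gcongr
        exact pow_le_of_le_one (norm_nonneg _) (by norm_num) (by omega)
    have hz : ∀ k : ℕ, ∑' m : ℕ, c (m + n) * (((1 / 2 : ℂ)) ^ (k + 1)) ^ m = 0 := fun k =>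
      (h1 _ (pow_ne_zero _ (by norm_num)) (norm_pow_lt (by norm_num) (by omega))).tsum_eq
    simp only [hz] at hlim
    have := tendsto_nhds_unique hlim tendsto_const_nhds
    rw [(hasSum_ite_eq (0 : ℕ) (c n)).tsum_eq] at this
    exact this

/-- complex version of `half` -/
noncomputable def chalf (f : ℕ → ℂ) (n : ℕ) : ℂ := if 2 ∣ n then f (n / 2) else 0

lemma chalf_hasSum {f : ℕ → ℂ} {q s : ℂ} (h : HasSum (fun n => f n * (q ^ 2) ^ n) s) :
    HasSum (fun n => chalf f n * q ^ n) s := by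
  refine even_only (fun k => ?_) (hasSum_of_eq h (fun k => ?_) rfl)
  · have : ¬ (2 ∣ 2 * k + 1) := by omega
    simp [chalf, this]
  · simp [chalf, pow_mul]

theorem representation_formula_3
    (a1 a2 : ℕ → ℤ)
    (ha1 : ∀ z : ℂ, 0 < z.im →
      dedekindEta z ^ (-2 : ℤ) * dedekindEta (2 * z) ^ (11 : ℤ) * dedekindEta (4 * z) ^ (-3 : ℤ) * dedekindEta (8 * z) ^ (2 : ℤ)
        = ∑' m : ℕ, (a1 (m + 1) : ℂ) * Complex.exp (2 * Real.pi * Complex.I * z) ^ (m + 1))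
    (ha2 : ∀ z : ℂ, 0 < z.im →
      dedekindEta z ^ (2 : ℤ) * dedekindEta (2 * z) ^ (-3 : ℤ) * dedekindEta (4 * z) ^ (11 : ℤ) * dedekindEta (8 * z) ^ (-2 : ℤ)
        = ∑' m : ℕ, (a2 (m + 1) : ℂ) * Complex.exp (2 * Real.pi * Complex.I * z) ^ (m + 1))
    (n : ℕ) (hn : 0 < n) :
    (repCount ![1, 1, 2, 4, 4, 4, 4, 4] n : ℚ) =
    (((4 : ℚ) / 11) * (sigmaChi8One n : ℚ) + ((2 : ℚ) / 11) * half sigmaOneChi8 n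
      + ((12 : ℚ) / 11) * (a1 n : ℚ) + ((28 : ℚ) / 11) * (a2 n : ℚ)
      + ((92 : ℚ) / 11) * half a1 n + ((-28 : ℚ) / 11) * half a2 n) := by
  have key := coeff_zero (c := fun n => (repCount ![1, 1, 2, 4, 4, 4, 4, 4] n : ℂ) -
    (4 / 11 * (sigmaChi8One n : ℂ) + 2 / 11 * chalf (fun k => (sigmaOneChi8 k : ℂ)) n + 12 / 11 * cut a1 n
      + 28 / 11 * cut a2 n + 92 / 11 * chalf (cut a1) n + (-28) / 11 * chalf (cut a2) n + if n = 0 then 1 else 0)) (by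
    intro q hq0 hq
    have hq2 := norm_sq_lt hq
    have hq20 := pow_ne_zero 2 hq0
    have hth := theta_gen hq0 hq ![1, 1, 2, 4, 4, 4, 4, 4] (by decide)
    have s1 := (sigmaChi_gen hq).mul_left (4 / 11)
    have s2 := (chalf_hasSum (sigmaOne_gen hq2)).mul_left (2 / 11)
    have s3 := (a1_gen ha1 hq0 hq).mul_left (12 / 11)
    have s4 := (a2_gen ha2 hq0 hq).mul_left (28 / 11)
    have s5 := (chalf_hasSum (a1_gen ha1 hq20 hq2)).mul_left (92 / 11)
    have s6 := (chalf_hasSum (a2_gen ha2 hq20 hq2)).mul_left (-28 / 11)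
    have s7 := hasSum_ite_eq (0 : ℕ) (1 : ℂ)
    refine hasSum_of_eq (hth.sub ((((((s1.add s2).add s3).add s4).add s5).add s6).add s7)) (fun m => ?_) ?_
    · rcases eq_or_ne m 0 with rfl | hm
      · simp
      · simp only [hm, if_false]
        ring
    · rw [E1_formula hq0 hq]
      have hE := EL_formula hq20 hq2
      have hA := alg_final _ _ _ (phi_rel hq0 hq)
      have e : (q ^ 2) ^ 2 = q ^ 4 := by ring
      rw [e] at hE ⊢
      unfold PP at hE
      have hP : ∏ i, phi (q ^ (![1, 1, 2, 4, 4, 4, 4, 4] : Fin 8 → ℕ) i) = phi q ^ 2 * phi (q ^ 2) * phi (q ^ 4) ^ 5 := by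
        simp [Fin.prod_univ_succ]
        ring
      rw [hP]
      linear_combination hA - 2 / 11 * hE) n
  have h0 : n ≠ 0 := hn.ne'
  have hc : ∀ f : ℕ → ℤ, chalf (cut f) n = ((half f n : ℚ) : ℂ) := by
    intro f
    unfold chalf half cut
    split_ifs with h1 h2
    · omega
    · push_cast; rfl
    · simp
  have hc' : chalf (fun k => (sigmaOneChi8 k : ℂ)) n = ((half sigmaOneChi8 n : ℚ) : ℂ) := by
    unfold chalf half
    split_ifs with h1
    · push_cast; rfl
    · simp
  simp only [hc, hc', cut, h0, if_false] at key
  have key2 := sub_eq_zero.mp key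
  rw [add_zero] at key2
  apply Rat.cast_injective (α := ℂ)
  push_cast
  linear_combination key2
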